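/- arXiv:1209.4791 — 6 statements merged into one kernel-verified Lean document; each statement's English description precedes it below -/
import Mathlib

section
/- Let n ≥ 2 and let G = QuaternionGroup n, the dicyclic group of order 4n. If g ∈ G has order at least 3, then the centralizer of g in G is a cyclic group. -/
namespace ZMod

theorem eq_zero_or_eq_of_add_self_eq_zero {n : ℕ} [NeZero n] {k : ZMod (2 * n)}
    (h : k + k = 0) : k = 0 ∨ k = n := by
  have hlt := k.val_lt
  rw [← natCast_zmod_val k] at h ⊢
  rw [← Nat.cast_add, natCast_eq_zero_iff, ← two_mul] at h
  obtain ⟨c, hc⟩ := Nat.dvd_of_mul_dvd_mul_left two_pos h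
  have hc2 : c < 2 := by
    by_contra! hc2
    nlinarith [Nat.mul_le_mul_left n hc2]
  interval_cases c
  · exact .inl (by simp [hc])
  · exact .inr (by simp [hc])

end ZMod

namespace QuaternionGroup

variable {n : ℕ}

theorem a_mem_zpowers_a_one [NeZero n] (i : ZMod (2 * n)) :
    a i ∈ Subgroup.zpowers (a 1 : QuaternionGroup n) :=
  Subgroup.mem_zpowers_iff.mpr ⟨i.val, by rw [zpow_natCast, a_one_pow, ZMod.natCast_zmod_val]⟩

theorem centralizer_a_le_zpowers_a_one [NeZero n] {i : ZMod (2 * n)} (hi : i + i ≠ 0) :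
    Subgroup.centralizer {a i} ≤ Subgroup.zpowers (a 1 : QuaternionGroup n) := by
  rintro (j | j) hj
  · exact a_mem_zpowers_a_one j
  · rw [Subgroup.mem_centralizer_singleton_iff, a_mul_xa, xa_mul_a, xa.injEq] at hj
    exact absurd (by linear_combination hj) hi

theorem centralizer_xa_le_zpowers_xa [NeZero n] (i : ZMod (2 * n)) :
    Subgroup.centralizer {xa i} ≤ Subgroup.zpowers (xa i : QuaternionGroup n) := by
  have hmem := Subgroup.mem_zpowers (xa i : QuaternionGroup n)
  have hn : a n ∈ Subgroup.zpowers (xa i : QuaternionGroup n) :=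
    xa_sq i ▸ pow_mem hmem 2
  rintro (j | j) hj <;> rw [Subgroup.mem_centralizer_singleton_iff] at hj
  · rw [a_mul_xa, xa_mul_a, xa.injEq] at hj
    have hjj : j + j = 0 := by linear_combination -hj
    obtain rfl | rfl := ZMod.eq_zero_or_eq_of_add_self_eq_zero hjj
    · exact one_mem _
    · exact hn
  · rw [xa_mul_xa, xa_mul_xa, a.injEq] at hj
    have hjj : (j - i) + (j - i) = 0 := by linear_combination -hj
    obtain h | h := ZMod.eq_zero_or_eq_of_add_self_eq_zero hjj
    · rwa [sub_eq_zero.mp h]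
    · rw [sub_eq_iff_eq_add'.mp h, ← xa_mul_a]
      exact mul_mem hmem hn

end QuaternionGroup

/-- In the dicyclic group `QuaternionGroup n` of order `4n` (`n ≥ 2`),
the centralizer of any element of order at least `3` is cyclic. -/
theorem centralizer_isCyclic_quaternionGroup (n : ℕ) (hn : 2 ≤ n)
    (g : QuaternionGroup n) (hg : 3 ≤ orderOf g) :
    IsCyclic (Subgroup.centralizer {g}) := by
  have : NeZero n := ⟨by omega⟩
  rcases g with i | i
  · refine Subgroup.isCyclic_of_le (QuaternionGroup.centralizer_a_le_zpowers_a_one fun hi => ?_)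
    have hsq : QuaternionGroup.a i ^ 2 = 1 := by
      rw [sq, QuaternionGroup.a_mul_a, hi, QuaternionGroup.a_zero]
    have := orderOf_le_of_pow_eq_one two_pos hsq
    omega
  · exact Subgroup.isCyclic_of_le (QuaternionGroup.centralizer_xa_le_zpowers_xa i)
end

section
/- Let G = SL(2, ZMod 5), the binary icosahedral group I*. If g ∈ G has order at least 3, then the centralizer of g in G is a cyclic group. -/
/-- A `2 × 2` matrix commuting with a non-scalar matrix `A` is a polynomial in `A`. -/
theorem Matrix.exists_eq_smul_one_add_smul_of_commute {K : Type*} [Field K]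
    {A B : Matrix (Fin 2) (Fin 2) K} (hA : ∀ r : K, A ≠ r • 1) (h : Commute A B) :
    ∃ p q : K, B = p • 1 + q • A := by
  have h' := h.eq
  rw [← Matrix.ext_iff] at h'
  simp only [Fin.forall_fin_two, Matrix.mul_apply, Fin.sum_univ_two] at h'
  obtain ⟨⟨h00, h01⟩, h10, h11⟩ := h'
  have key : ∃ q : K, B 0 1 = q * A 0 1 ∧ B 1 0 = q * A 1 0 ∧
      B 0 0 - B 1 1 = q * (A 0 0 - A 1 1) := by
    by_cases hb : A 0 1 = 0
    · by_cases hc : A 1 0 = 0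
      · have hd : A 0 0 - A 1 1 ≠ 0 := by
          intro hd
          refine hA (A 0 0) ?_
          ext i j
          fin_cases i <;> fin_cases j <;> simp [hb, hc]
          linear_combination -hd
        refine ⟨(B 0 0 - B 1 1) / (A 0 0 - A 1 1), ?_, ?_, ?_⟩ <;> field_simp
        · rw [hb] at h01 ⊢
          linear_combination h01
        · rw [hc] at h10 ⊢
          linear_combination -h10
      · refine ⟨B 1 0 / A 1 0, ?_, ?_, ?_⟩ <;> field_simp
        · linear_combination -h00
        · linear_combination h10
    · refine ⟨B 0 1 / A 0 1, ?_, ?_, ?_⟩ <;> field_simp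
      · linear_combination h00
      · linear_combination -h01
  obtain ⟨q, h1, h2, h3⟩ := key
  refine ⟨B 0 0 - q * A 0 0, q, ?_⟩
  ext i j
  fin_cases i <;> fin_cases j <;> simp [h1, h2]
  linear_combination -h3

theorem Matrix.det_smul_one_add_smul_fin_two {R : Type*} [CommRing R]
    (A : Matrix (Fin 2) (Fin 2) R) (p q : R) :
    (p • 1 + q • A).det = p ^ 2 + p * q * A.trace + q ^ 2 * A.det := by
  simp [Matrix.det_fin_two, Matrix.trace_fin_two]
  ring

/-- Multiplication by `X` on `p + q X` modulo `X ^ 2 - t X + 1`. -/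
def mulRootStep {R : Type*} [CommRing R] (t : R) (v : R × R) : R × R :=
  (-v.2, v.1 + t * v.2)

theorem Matrix.pow_eq_iterate_mulRootStep {R : Type*} [CommRing R]
    (A : Matrix (Fin 2) (Fin 2) R) (hA : A.det = 1) (n : ℕ) :
    A ^ n = ((mulRootStep A.trace)^[n] (1, 0)).1 • 1 +
      ((mulRootStep A.trace)^[n] (1, 0)).2 • A := by
  induction n with
  | zero => simp
  | succ n ih =>
    have hsq : A * A = A.trace • A - 1 := by
      rw [Matrix.det_fin_two] at hA
      ext i j
      fin_cases i <;> fin_cases j <;>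
        simp [Matrix.mul_apply, Matrix.trace_fin_two] <;> first | ring1 | linear_combination -hA
    rw [pow_succ, ih, Function.iterate_succ_apply']
    simp only [mulRootStep, add_mul, smul_mul_assoc, one_mul, hsq]
    module

theorem exists_iterate_mulRootStep_eq :
    ∀ t : ZMod 5, (t = 0 ∨ t = 1 ∨ t = -2) → ∀ p q : ZMod 5, p ^ 2 + p * q * t + q ^ 2 = 1 →
      ∃ n : Fin 10, (mulRootStep t)^[(n : ℕ)] (1, 0) = (p, q) := by
  unfold mulRootStep
  decide

namespace Matrix.SpecialLinearGroup

theorem mem_zpowers_of_commute_of_trace {k h : SpecialLinearGroup (Fin 2) (ZMod 5)}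
    (hk : ∀ r : ZMod 5, (k : Matrix (Fin 2) (Fin 2) (ZMod 5)) ≠ r • 1)
    (ht : k.1.trace = 0 ∨ k.1.trace = 1 ∨ k.1.trace = -2) (hkh : k * h = h * k) :
    h ∈ Subgroup.zpowers k := by
  have : Fact (Nat.Prime 5) := ⟨Nat.prime_five⟩
  obtain ⟨p, q, hpq⟩ := Matrix.exists_eq_smul_one_add_smul_of_commute hk
    (B := (h : Matrix (Fin 2) (Fin 2) (ZMod 5))) (by
      rw [Commute, SemiconjBy, ← coe_mul, hkh, coe_mul])
  have hdet := Matrix.det_smul_one_add_smul_fin_two k.1 p q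
  rw [← hpq, h.2, k.2, mul_one] at hdet
  obtain ⟨n, hn⟩ := exists_iterate_mulRootStep_eq _ ht p q hdet.symm
  refine ⟨(n : ℕ), Subtype.ext ?_⟩
  have hpow := Matrix.pow_eq_iterate_mulRootStep k.1 k.2 n
  rw [hn, ← hpq] at hpow
  simpa using hpow

theorem ne_smul_one_of_three_le_orderOf {R : Type*} [CommRing R]
    {g : SpecialLinearGroup (Fin 2) R} (hg : 3 ≤ orderOf g) (r : R) :
    (g : Matrix (Fin 2) (Fin 2) R) ≠ r • 1 := by
  intro h
  have hdet := g.2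
  rw [h, Matrix.det_smul, Fintype.card_fin, Matrix.det_one, mul_one] at hdet
  have hsq : g ^ 2 = 1 := Subtype.ext <| by
    rw [coe_pow, h, smul_pow, hdet, one_pow, one_smul, coe_one]
  have := orderOf_le_of_pow_eq_one two_pos hsq
  omega

theorem isCyclic_centralizer_of_trace {k : SpecialLinearGroup (Fin 2) (ZMod 5)}
    (hk : ∀ r : ZMod 5, (k : Matrix (Fin 2) (Fin 2) (ZMod 5)) ≠ r • 1)
    (ht : k.1.trace = 0 ∨ k.1.trace = 1 ∨ k.1.trace = -2) :
    IsCyclic (Subgroup.centralizer {k}) := by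
  have h : Subgroup.centralizer {k} = Subgroup.zpowers k := by
    apply le_antisymm
    · intro h hh
      exact mem_zpowers_of_commute_of_trace hk ht (Subgroup.mem_centralizer_singleton_iff.1 hh).symm
    · rw [Subgroup.zpowers_le, Subgroup.mem_centralizer_singleton_iff]
  rw [h]
  infer_instance

end Matrix.SpecialLinearGroup

/-- In the binary icosahedral group `SL(2, ℤ/5)`, the centralizer of any
element of order at least `3` is cyclic. -/
theorem centralizer_isCyclic_binaryIcosahedral
    (g : Matrix.SpecialLinearGroup (Fin 2) (ZMod 5)) (hg : 3 ≤ orderOf g) :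
    IsCyclic (Subgroup.centralizer {g}) := by
  have hne := Matrix.SpecialLinearGroup.ne_smul_one_of_three_le_orderOf hg
  have htrace : ∀ t : ZMod 5, (t = 0 ∨ t = 1 ∨ t = -2) ∨ (-t = 0 ∨ -t = 1 ∨ -t = -2) := by
    decide
  rcases htrace g.1.trace with ht | ht
  · exact Matrix.SpecialLinearGroup.isCyclic_centralizer_of_trace hne ht
  · have hneg : Subgroup.centralizer {g} = Subgroup.centralizer {-g} := by
      ext h
      simp [Subgroup.mem_centralizer_singleton_iff]
    rw [hneg]
    apply Matrix.SpecialLinearGroup.isCyclic_centralizer_of_trace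
    · intro r hr
      refine hne (-r) ?_
      rw [neg_smul, ← hr, Matrix.SpecialLinearGroup.coe_neg, neg_neg]
    · rw [← Matrix.trace_neg] at ht
      exact ht
end

section
/- In the binary octahedral group O*: (i) there are exactly two conjugacy classes of elements of order 4; (ii) every element g of order 4 is conjugate to g⁻¹; (iii) there are exactly two orbits of the conjugation action of O* on the set of cyclic subgroups of O* of order 4. (Consequently r₁(4) = r₂(4) = 2.) -/
/-- The defining relators of the binary octahedral group `O*`, on generators
`X = of 0`, `P = of 1`, `Q = of 2`, `R = of 3`:
`X³ = 1`, `P² = Q² = R²`, `PQP⁻¹ = Q⁻¹`, `XPX⁻¹ = Q`, `XQX⁻¹ = PQ`,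
`RXR⁻¹ = X⁻¹`, `RPR⁻¹ = QP`, `RQR⁻¹ = Q⁻¹`. -/
def binaryOctahedralRels : Set (FreeGroup (Fin 4)) :=
  { FreeGroup.of 0 ^ 3,
    FreeGroup.of 1 ^ 2 * (FreeGroup.of 2 ^ 2)⁻¹,
    FreeGroup.of 1 ^ 2 * (FreeGroup.of 3 ^ 2)⁻¹,
    FreeGroup.of 1 * FreeGroup.of 2 * (FreeGroup.of 1)⁻¹ * FreeGroup.of 2,
    FreeGroup.of 0 * FreeGroup.of 1 * (FreeGroup.of 0)⁻¹ * (FreeGroup.of 2)⁻¹,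
    FreeGroup.of 0 * FreeGroup.of 2 * (FreeGroup.of 0)⁻¹ *
      (FreeGroup.of 1 * FreeGroup.of 2)⁻¹,
    FreeGroup.of 3 * FreeGroup.of 0 * (FreeGroup.of 3)⁻¹ * FreeGroup.of 0,
    FreeGroup.of 3 * FreeGroup.of 1 * (FreeGroup.of 3)⁻¹ *
      (FreeGroup.of 2 * FreeGroup.of 1)⁻¹,
    FreeGroup.of 3 * FreeGroup.of 2 * (FreeGroup.of 3)⁻¹ * FreeGroup.of 2 }

/-- The binary octahedral group `O*` of order `48`, as a presented group. -/
abbrev BinaryOctahedral : Type := PresentedGroup binaryOctahedralRels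

namespace BinaryOctahedral

/-- The `i`-th of the generators `X`, `P`, `Q`, `R` of `O*`. -/
abbrev gen (i : Fin 4) : BinaryOctahedral := PresentedGroup.of i

local notation "X" => gen 0
local notation "P" => gen 1
local notation "Q" => gen 2
local notation "R" => gen 3

theorem X_pow_three : X ^ 3 = 1 :=
  PresentedGroup.one_of_mem (rels := binaryOctahedralRels) (by simp [binaryOctahedralRels])

theorem P_sq_eq_Q_sq : P ^ 2 = Q ^ 2 :=
  mul_inv_eq_one.1 <| PresentedGroup.one_of_mem (rels := binaryOctahedralRels)
    (x := FreeGroup.of 1 ^ 2 * (FreeGroup.of 2 ^ 2)⁻¹) (by simp [binaryOctahedralRels])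

theorem P_sq_eq_R_sq : P ^ 2 = R ^ 2 :=
  mul_inv_eq_one.1 <| PresentedGroup.one_of_mem (rels := binaryOctahedralRels)
    (x := FreeGroup.of 1 ^ 2 * (FreeGroup.of 3 ^ 2)⁻¹) (by simp [binaryOctahedralRels])

theorem conj_P_Q : P * Q * P⁻¹ = Q⁻¹ :=
  mul_eq_one_iff_eq_inv.1 <| PresentedGroup.one_of_mem (rels := binaryOctahedralRels)
    (x := FreeGroup.of 1 * FreeGroup.of 2 * (FreeGroup.of 1)⁻¹ * FreeGroup.of 2)
    (by simp [binaryOctahedralRels])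

theorem X_mul_P : X * P = Q * X :=
  mul_inv_eq_iff_eq_mul.1 <| mul_inv_eq_one.1 <|
    PresentedGroup.one_of_mem (rels := binaryOctahedralRels)
    (x := FreeGroup.of 0 * FreeGroup.of 1 * (FreeGroup.of 0)⁻¹ * (FreeGroup.of 2)⁻¹)
    (by simp [binaryOctahedralRels])

theorem X_mul_Q : X * Q = P * Q * X :=
  mul_inv_eq_iff_eq_mul.1 <| mul_inv_eq_one.1 <|
    PresentedGroup.one_of_mem (rels := binaryOctahedralRels)
    (x := FreeGroup.of 0 * FreeGroup.of 2 * (FreeGroup.of 0)⁻¹ *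
      (FreeGroup.of 1 * FreeGroup.of 2)⁻¹)
    (by simp [binaryOctahedralRels])

theorem conj_R_X : R * X * R⁻¹ = X⁻¹ :=
  mul_eq_one_iff_eq_inv.1 <| PresentedGroup.one_of_mem (rels := binaryOctahedralRels)
    (x := FreeGroup.of 3 * FreeGroup.of 0 * (FreeGroup.of 3)⁻¹ * FreeGroup.of 0)
    (by simp [binaryOctahedralRels])

theorem R_mul_P : R * P = Q * P * R :=
  mul_inv_eq_iff_eq_mul.1 <| mul_inv_eq_one.1 <|
    PresentedGroup.one_of_mem (rels := binaryOctahedralRels)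
    (x := FreeGroup.of 3 * FreeGroup.of 1 * (FreeGroup.of 3)⁻¹ *
      (FreeGroup.of 2 * FreeGroup.of 1)⁻¹)
    (by simp [binaryOctahedralRels])

theorem conj_R_Q : R * Q * R⁻¹ = Q⁻¹ :=
  mul_eq_one_iff_eq_inv.1 <| PresentedGroup.one_of_mem (rels := binaryOctahedralRels)
    (x := FreeGroup.of 3 * FreeGroup.of 2 * (FreeGroup.of 3)⁻¹ * FreeGroup.of 2)
    (by simp [binaryOctahedralRels])

theorem P_pow_four : P ^ 4 = 1 := by
  have h : (P * Q * P⁻¹) ^ 2 = Q⁻¹ ^ 2 := by rw [conj_P_Q]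
  rw [conj_pow, ← P_sq_eq_Q_sq, inv_pow, ← P_sq_eq_Q_sq, ← pow_succ', pow_succ,
    mul_inv_cancel_right] at h
  exact (pow_add P 2 2).trans (mul_eq_one_iff_eq_inv.2 h)

theorem Q_pow_four : Q ^ 4 = 1 := by
  rw [pow_mul Q 2 2, ← P_sq_eq_Q_sq, ← pow_mul, P_pow_four]

theorem R_pow_four : R ^ 4 = 1 := by
  rw [pow_mul R 2 2, ← P_sq_eq_R_sq, ← pow_mul, P_pow_four]

theorem Q_inv : Q⁻¹ = Q ^ 3 :=
  inv_eq_of_mul_eq_one_right (by rw [← pow_succ', Q_pow_four])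

theorem Q_mul_P : Q * P = P * Q ^ 3 := by
  have h := conj_P_Q
  rw [← Q_inv, eq_mul_inv_iff_mul_eq, mul_assoc, ← eq_inv_mul_iff_mul_eq, ← h]
  group

theorem R_mul_Q : R * Q = Q ^ 3 * R := by
  rw [← mul_inv_eq_iff_eq_mul, conj_R_Q, Q_inv]

theorem X_mul_R : X * R = R * X ^ 2 := by
  have h : X ^ 2 = X⁻¹ := eq_inv_of_mul_eq_one_left (by rw [← pow_succ, X_pow_three])
  rw [h, eq_mul_inv_iff_mul_eq, mul_assoc, ← eq_inv_mul_iff_mul_eq, ← mul_inv_eq_iff_eq_mul]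
  exact conj_R_X

/-- The quaternion subgroup generated by `P` and `Q`, through its normal form. -/
def quaternions : Submonoid BinaryOctahedral where
  carrier := {g | ∃ c d : ℕ, g = P ^ c * Q ^ d}
  one_mem' := ⟨0, 0, by simp⟩
  mul_mem' := by
    rintro _ _ ⟨c, d, rfl⟩ ⟨c', d', rfl⟩
    have key : ∀ n : ℕ, Q ^ d * P ^ n = P ^ n * Q ^ (d * 3 ^ n) := by
      intro n
      induction n with
      | zero => simp
      | succ n ih =>
        have h : SemiconjBy P ((Q ^ 3) ^ (d * 3 ^ n)) (Q ^ (d * 3 ^ n)) :=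
          SemiconjBy.pow_right Q_mul_P.symm _
        rw [pow_succ, ← mul_assoc, ih, mul_assoc, ← h.eq, ← pow_mul, ← mul_assoc]
        congr 2
        ring
    refine ⟨c + c', d * 3 ^ c' + d', ?_⟩
    rw [pow_add, pow_add, mul_assoc, ← mul_assoc (Q ^ d), key]
    simp only [mul_assoc]

theorem P_mem : P ∈ quaternions := ⟨1, 0, by simp⟩

theorem Q_mem : Q ∈ quaternions := ⟨0, 1, by simp⟩

theorem exists_X_mul {q : BinaryOctahedral} (hq : q ∈ quaternions) :
    ∃ q' ∈ quaternions, X * q = q' * X := by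
  obtain ⟨c, d, rfl⟩ := hq
  exact ⟨Q ^ c * (P * Q) ^ d,
    mul_mem (pow_mem Q_mem _) (pow_mem (mul_mem P_mem Q_mem) _),
    (SemiconjBy.pow_right X_mul_P c).mul_right (SemiconjBy.pow_right X_mul_Q d)⟩

theorem exists_R_mul {q : BinaryOctahedral} (hq : q ∈ quaternions) :
    ∃ q' ∈ quaternions, R * q = q' * R := by
  obtain ⟨c, d, rfl⟩ := hq
  exact ⟨(Q * P) ^ c * (Q ^ 3) ^ d,
    mul_mem (pow_mem (mul_mem Q_mem P_mem) _) (pow_mem (pow_mem Q_mem _) _),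
    (SemiconjBy.pow_right R_mul_P c).mul_right (SemiconjBy.pow_right R_mul_Q d)⟩

theorem X_mul_R_pow (b : ℕ) : X * R ^ b = R ^ b * X ^ 2 ^ b := by
  induction b with
  | zero => simp
  | succ b ih =>
    have h : SemiconjBy R ((X ^ 2) ^ 2 ^ b) (X ^ 2 ^ b) :=
      SemiconjBy.pow_right X_mul_R.symm _
    rw [pow_succ, ← mul_assoc, ih, mul_assoc, ← h.eq, ← pow_mul, ← mul_assoc, ← pow_succ']

/-- Multiplying a product `q * R ^ b * X ^ a` on the left by a generator gives such a product. -/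
theorem exists_gen_mul (i : Fin 4) {g : BinaryOctahedral}
    (hg : ∃ q ∈ quaternions, ∃ b a : ℕ, g = q * R ^ b * X ^ a) :
    ∃ q ∈ quaternions, ∃ b a : ℕ, gen i * g = q * R ^ b * X ^ a := by
  obtain ⟨q, hq, b, a, rfl⟩ := hg
  fin_cases i
  · obtain ⟨q', hq', h⟩ := exists_X_mul hq
    refine ⟨q', hq', b, 2 ^ b + a, ?_⟩
    change X * (q * R ^ b * X ^ a) = _
    rw [← mul_assoc, ← mul_assoc, h, mul_assoc q', X_mul_R_pow, pow_add]
    simp only [mul_assoc]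
  · exact ⟨P * q, mul_mem P_mem hq, b, a, by simp only [← mul_assoc]; rfl⟩
  · exact ⟨Q * q, mul_mem Q_mem hq, b, a, by simp only [← mul_assoc]; rfl⟩
  · obtain ⟨q', hq', h⟩ := exists_R_mul hq
    refine ⟨q', hq', b + 1, a, ?_⟩
    change R * (q * R ^ b * X ^ a) = _
    rw [← mul_assoc, ← mul_assoc, h, mul_assoc q', ← pow_succ']

theorem gen_pow_twelve (i : Fin 4) : gen i ^ 12 = 1 := by
  fin_cases i
  · exact (pow_mul X 3 4).trans (by rw [X_pow_three, one_pow])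
  · exact (pow_mul P 4 3).trans (by rw [P_pow_four, one_pow])
  · exact (pow_mul Q 4 3).trans (by rw [Q_pow_four, one_pow])
  · exact (pow_mul R 4 3).trans (by rw [R_pow_four, one_pow])

theorem exists_eq_mul_pow (g : BinaryOctahedral) :
    ∃ q ∈ quaternions, ∃ b a : ℕ, g = q * R ^ b * X ^ a := by
  have hg : g ∈ Subgroup.closure (Set.range (PresentedGroup.of (rels := binaryOctahedralRels))) := by
    rw [PresentedGroup.closure_range_of]
    trivial
  induction hg using Subgroup.closure_induction_left with
  | one => exact ⟨1, one_mem _, 0, 0, by simp⟩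
  | mul_left x hx y hy ih =>
    obtain ⟨i, rfl⟩ := hx
    exact exists_gen_mul i ih
  | inv_mul_cancel x hx y hy ih =>
    obtain ⟨i, rfl⟩ := hx
    have h : ∀ n : ℕ, ∃ q ∈ quaternions, ∃ b a : ℕ, gen i ^ n * y = q * R ^ b * X ^ a := by
      intro n
      induction n with
      | zero => simpa using ih
      | succ n ihn =>
        rw [pow_succ', mul_assoc]
        exact exists_gen_mul i ihn
    have hi : (gen i)⁻¹ = gen i ^ 11 :=
      inv_eq_of_mul_eq_one_right (by rw [← pow_succ', gen_pow_twelve])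
    rw [hi]
    exact h 11

/-- The word `P ^ c * Q ^ d * R ^ b * X ^ a` in four elements of a monoid, for `t = (c, d, b, a)`. -/
def word {M : Type*} [Monoid M] (v : Fin 4 → M) (t : Fin 4 × Fin 2 × Fin 2 × Fin 3) : M :=
  v 1 ^ (t.1 : ℕ) * v 2 ^ (t.2.1 : ℕ) * v 3 ^ (t.2.2.1 : ℕ) * v 0 ^ (t.2.2.2 : ℕ)

theorem map_word {M N : Type*} [Monoid M] [Monoid N] (f : M →* N) (v : Fin 4 → M)
    (t : Fin 4 × Fin 2 × Fin 2 × Fin 3) : f (word v t) = word (fun i => f (v i)) t := by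
  simp [word]

theorem word_surjective : Function.Surjective (word gen) := by
  intro g
  obtain ⟨q, hq, b, a, rfl⟩ := exists_eq_mul_pow g
  obtain ⟨c, d, h⟩ : q * (P ^ 2) ^ (b / 2) ∈ quaternions :=
    mul_mem hq (pow_mem (pow_mem P_mem _) _)
  refine ⟨(Fin.ofNat 4 (c + 2 * (d / 2)), Fin.ofNat 2 d, Fin.ofNat 2 b, Fin.ofNat 3 a), ?_⟩
  have hb : R ^ b = (P ^ 2) ^ (b / 2) * R ^ (b % 2) := by
    rw [P_sq_eq_R_sq, ← pow_mul, ← pow_add, Nat.div_add_mod]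
  have hd : Q ^ d = (P ^ 2) ^ (d / 2) * Q ^ (d % 2) := by
    rw [P_sq_eq_Q_sq, ← pow_mul, ← pow_add, Nat.div_add_mod]
  rw [hb, ← mul_assoc q, h, hd, ← mul_assoc (P ^ c), ← pow_mul, ← pow_add,
    pow_eq_pow_mod a X_pow_three, pow_eq_pow_mod (c + 2 * (d / 2)) P_pow_four]
  rfl

/-- The images of the generators in a faithful representation of `O*` in dimension two over the
field with seven elements. -/
def mat : Fin 4 → (Matrix (Fin 2) (Fin 2) (ZMod 7))ˣ :=
  ![⟨!![4, 6; 0, 2], !![2, 1; 0, 4], by decide, by decide⟩,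
    ⟨!![0, 1; 6, 0], !![0, 6; 1, 0], by decide, by decide⟩,
    ⟨!![2, 3; 3, 5], !![5, 4; 4, 2], by decide, by decide⟩,
    ⟨!![6, 1; 5, 1], !![1, 6; 2, 6], by decide, by decide⟩]

/-- A faithful representation of `O*` in dimension two over the field with seven elements. -/
def rep : BinaryOctahedral →* (Matrix (Fin 2) (Fin 2) (ZMod 7))ˣ :=
  PresentedGroup.toGroup (f := mat) (by
    simp only [binaryOctahedralRels, Set.mem_insert_iff, Set.mem_singleton_iff]
    rintro _ (rfl | rfl | rfl | rfl | rfl | rfl | rfl | rfl | rfl) <;>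
      simp only [map_mul, map_pow, map_inv, FreeGroup.lift_apply_of] <;> decide +kernel)

theorem rep_gen (i : Fin 4) : rep (gen i) = mat i := PresentedGroup.toGroup.of _

theorem rep_word (t : Fin 4 × Fin 2 × Fin 2 × Fin 3) : rep (word gen t) = word mat t := by
  simp only [map_word, rep_gen]

theorem rep_injective : Function.Injective rep := by
  rw [injective_iff_map_eq_one]
  intro g hg
  obtain ⟨t, rfl⟩ := word_surjective g
  rw [rep_word] at hg
  have h : ∀ t, word mat t = 1 → t = 0 := by decide +kernel
  simp [h t hg, word]

theorem isConj_iff_exists_mat (g h : BinaryOctahedral) :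
    IsConj g h ↔ ∃ s, word mat s * rep g = rep h * word mat s := by
  simp only [isConj_iff, mul_inv_eq_iff_eq_mul, ← rep_word, ← map_mul, rep_injective.eq_iff]
  exact word_surjective.exists

theorem isConj_P_or_R {g : BinaryOctahedral} (hg : orderOf g = 4) : IsConj g P ∨ IsConj g R := by
  obtain ⟨t, rfl⟩ := word_surjective g
  have h4 : word mat t ^ 4 = 1 := by
    rw [← rep_word, ← map_pow, orderOf_dvd_iff_pow_eq_one.1 hg.dvd, map_one]
  have h2 : word mat t ^ 2 ≠ 1 := by
    rw [← rep_word, ← map_pow, ← map_one rep, rep_injective.ne_iff]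
    exact pow_ne_one_of_lt_orderOf (by simp) (by omega)
  have key : ∀ t, word mat t ^ 4 = 1 → word mat t ^ 2 ≠ 1 →
      (∃ s, word mat s * word mat t = mat 1 * word mat s) ∨
        ∃ s, word mat s * word mat t = mat 3 * word mat s := by decide +kernel
  simpa only [isConj_iff_exists_mat, rep_word, rep_gen] using key t h4 h2

theorem not_isConj_P_R_pow (k : ℕ) : ¬ IsConj P (R ^ k) := by
  have key : ∀ k : Fin 4, ¬ ∃ s, word mat s * mat 1 = mat 3 ^ (k : ℕ) * word mat s := by
    decide +kernel
  rw [pow_eq_pow_mod k R_pow_four, isConj_iff_exists_mat, map_pow, rep_gen, rep_gen]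
  exact key ⟨k % 4, Nat.mod_lt _ (by simp)⟩

theorem orderOf_P : orderOf P = 4 := by
  refine orderOf_eq_prime_pow (p := 2) (n := 1) ?_ P_pow_four
  rw [← rep_injective.eq_iff, map_pow, map_one, rep_gen]
  decide +kernel

theorem orderOf_R : orderOf R = 4 := by
  refine orderOf_eq_prime_pow (p := 2) (n := 1) ?_ R_pow_four
  rw [← rep_injective.eq_iff, map_pow, map_one, rep_gen]
  decide +kernel

theorem isConj_inv {g : BinaryOctahedral} (hg : orderOf g = 4) : IsConj g g⁻¹ := by
  have key : ∀ {x}, IsConj g x → IsConj x x⁻¹ → IsConj g g⁻¹ := by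
    intro x hx h
    obtain ⟨c, rfl⟩ := isConj_iff.1 hx
    exact hx.trans (h.trans (isConj_iff.2 ⟨c⁻¹, by group⟩))
  rcases isConj_P_or_R hg with h | h
  · refine key h ((isConj_iff_exists_mat _ _).2 ?_)
    rw [map_inv, rep_gen]
    decide +kernel
  · refine key h ((isConj_iff_exists_mat _ _).2 ?_)
    rw [map_inv, rep_gen]
    decide +kernel

theorem exists_zpowers_eq {G : Type*} [Group G] {H : Subgroup G} {n : ℕ}
    (h : IsCyclic H ∧ Nat.card H = n) : ∃ g : G, orderOf g = n ∧ Subgroup.zpowers g = H := by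
  obtain ⟨g, rfl⟩ := (Subgroup.isCyclic_iff_exists_zpowers_eq_top H).1 h.1
  exact ⟨g, by rw [← Nat.card_zpowers, h.2], rfl⟩

theorem map_conj_zpowers {G : Type*} [Group G] (c g : G) :
    Subgroup.map (MulAut.conj c).toMonoidHom (Subgroup.zpowers g) =
      Subgroup.zpowers (c * g * c⁻¹) := by
  rw [MonoidHom.map_zpowers]
  rfl

end BinaryOctahedral

/-- A quotient has two elements if every element is related to one of two elements that are
separated by an invariant predicate. -/
theorem Quot.natCard_eq_two {α : Type*} {r : α → α → Prop} (f : α → Prop)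
    (hf : ∀ x y, r x y → (f x ↔ f y)) (a b : α) (ha : f a) (hb : ¬ f b)
    (h : ∀ x, r x a ∨ r x b) : Nat.card (Quot r) = 2 := by
  rw [Nat.card_eq_two_iff]
  refine ⟨Quot.mk r a, Quot.mk r b, fun hab => hb ?_, ?_⟩
  · have := congrArg (Quot.lift f fun x y hxy => propext (hf x y hxy)) hab
    exact this.mp ha
  · rw [Set.eq_univ_iff_forall]
    rintro ⟨x⟩
    exact (h x).imp (Quot.sound ·) (Quot.sound ·)

open BinaryOctahedral in
/-- In the binary octahedral group `O*`:
(i) there are exactly two conjugacy classes of elements of order `4`;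
(ii) every element `g` of order `4` is conjugate to `g⁻¹`;
(iii) there are exactly two orbits of the conjugation action of `O*` on the set of
cyclic subgroups of `O*` of order `4`. -/
theorem binaryOctahedral_order_four_classes :
    (Nat.card (Quot (fun g h : {g : BinaryOctahedral // orderOf g = 4} =>
        IsConj g.1 h.1)) = 2) ∧
    (∀ g : BinaryOctahedral, orderOf g = 4 → IsConj g g⁻¹) ∧
    (Nat.card (Quot (fun H K : {H : Subgroup BinaryOctahedral //
        IsCyclic H ∧ Nat.card H = 4} =>
        ∃ g : BinaryOctahedral,
          Subgroup.map (MulAut.conj g).toMonoidHom H.1 = K.1)) = 2) := by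
  refine ⟨?_, fun g => isConj_inv, ?_⟩
  · refine Quot.natCard_eq_two (fun x => IsConj (gen 1) x.1)
      (fun x y hxy => ⟨fun h => h.trans hxy, fun h => h.trans hxy.symm⟩)
      ⟨gen 1, orderOf_P⟩ ⟨gen 3, orderOf_R⟩ (IsConj.refl _) ?_ fun x => isConj_P_or_R x.2
    simpa using not_isConj_P_R_pow 1
  · refine Quot.natCard_eq_two (fun H => ∃ g ∈ H.1, IsConj (gen 1) g) ?_
      ⟨Subgroup.zpowers (gen 1), inferInstance, by rw [Nat.card_zpowers, orderOf_P]⟩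
      ⟨Subgroup.zpowers (gen 3), inferInstance, by rw [Nat.card_zpowers, orderOf_R]⟩
      ⟨gen 1, Subgroup.mem_zpowers _, IsConj.refl _⟩ ?_ ?_
    · rintro ⟨H, _⟩ ⟨_, _⟩ ⟨c, rfl⟩
      have hc : ∀ x : BinaryOctahedral, IsConj x (MulAut.conj c x) := fun x =>
        isConj_iff.2 ⟨c, rfl⟩
      constructor
      · rintro ⟨x, hx, h⟩
        exact ⟨_, Subgroup.mem_map_of_mem _ hx, h.trans (hc x)⟩
      · rintro ⟨_, ⟨x, hx, rfl⟩, h⟩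
        exact ⟨x, hx, h.trans (hc x).symm⟩
    · rintro ⟨x, hx, h⟩
      have hR : IsOfFinOrder (gen 3) := isOfFinOrder_iff_pow_eq_one.2 ⟨4, by simp, R_pow_four⟩
      obtain ⟨k, rfl⟩ := hR.mem_powers_iff_mem_zpowers.2 hx
      exact not_isConj_P_R_pow k h
    · rintro ⟨H, hH⟩
      obtain ⟨g, hg, rfl⟩ := exists_zpowers_eq hH
      refine (isConj_P_or_R hg).imp (fun h => ?_) fun h => ?_ <;>
      · obtain ⟨c, hc⟩ := isConj_iff.1 h
        exact ⟨c, by rw [map_conj_zpowers, hc]⟩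
end

section
/- There exist injective group homomorphisms φ₁ : QuaternionGroup 2 →* QuaternionGroup 4 and φ₂ : QuaternionGroup 2 →* SL(2, ZMod 3) such that B₄(S²) is isomorphic to the amalgamated free product of φ₁ and φ₂ along QuaternionGroup 2 (the pushout of the pair of injective homomorphisms). In other words, B₄(S²) ≅ Q₁₆ *_{Q₈} T*. -/
/-- The defining relators of the sphere braid group `B₄(S²)` on generators
`σ₁ = of 0`, `σ₂ = of 1`, `σ₃ = of 2`:
`σ₁σ₃ = σ₃σ₁`, `σ₁σ₂σ₁ = σ₂σ₁σ₂`, `σ₂σ₃σ₂ = σ₃σ₂σ₃`, `σ₁σ₂σ₃²σ₂σ₁ = 1`. -/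
def sphereBraidRels : Set (FreeGroup (Fin 3)) :=
  { FreeGroup.of 0 * FreeGroup.of 2 * (FreeGroup.of 2 * FreeGroup.of 0)⁻¹,
    FreeGroup.of 0 * FreeGroup.of 1 * FreeGroup.of 0 *
      (FreeGroup.of 1 * FreeGroup.of 0 * FreeGroup.of 1)⁻¹,
    FreeGroup.of 1 * FreeGroup.of 2 * FreeGroup.of 1 *
      (FreeGroup.of 2 * FreeGroup.of 1 * FreeGroup.of 2)⁻¹,
    FreeGroup.of 0 * FreeGroup.of 1 * FreeGroup.of 2 ^ 2 * FreeGroup.of 1 * FreeGroup.of 0 }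

/-- The braid group `B₄(S²)` of the sphere on four strings, as a presented group. -/
abbrev B4S2 : Type := PresentedGroup sphereBraidRels

/-- The generator `σᵢ₊₁` of `B₄(S²)`. -/
def σ (i : Fin 3) : B4S2 := PresentedGroup.of i

/-- The two-element family of groups `Q₁₆` (at `true`) and `T* = SL(2, ℤ/3)` (at `false`). -/
def AmalgFam : Bool → Type
  | true => QuaternionGroup 4
  | false => Matrix.SpecialLinearGroup (Fin 2) (ZMod 3)

instance : (b : Bool) → Group (AmalgFam b)
  | true => inferInstanceAs (Group (QuaternionGroup 4))
  | false => inferInstanceAs (Group (Matrix.SpecialLinearGroup (Fin 2) (ZMod 3)))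

/-- Package a pair of homomorphisms `Q₈ →* Q₁₆` and `Q₈ →* T*` as a family indexed by `Bool`. -/
def amalgMaps (φ₁ : QuaternionGroup 2 →* QuaternionGroup 4)
    (φ₂ : QuaternionGroup 2 →* Matrix.SpecialLinearGroup (Fin 2) (ZMod 3)) :
    (b : Bool) → QuaternionGroup 2 →* AmalgFam b
  | true => φ₁
  | false => φ₂

/-- The homomorphism from the cyclic group `ℤ/n` sending the generator to an element `g`
with `g ^ n = 1`. -/
def zmodPowersHom {n : ℕ} {G : Type*} [Group G] (g : G) (hg : g ^ n = 1) :
    Multiplicative (ZMod n) →* G :=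
  AddMonoidHom.toMultiplicativeLeft (ZMod.lift n ⟨zmultiplesHom (Additive G) (Additive.ofMul g), by
    rw [zmultiplesHom_apply, natCast_zsmul, ← ofMul_pow, hg, ofMul_one]⟩)

theorem zmodPowersHom_intCast {n : ℕ} {G : Type*} [Group G] (g : G) (hg : g ^ n = 1) (k : ℤ) :
    zmodPowersHom g hg (.ofAdd (k : ZMod n)) = g ^ k := by
  simp [zmodPowersHom]

theorem zmodPowersHom_apply {n : ℕ} [NeZero n] {G : Type*} [Group G] (g : G) (hg : g ^ n = 1)
    (i : ZMod n) : zmodPowersHom g hg (.ofAdd i) = g ^ i.val := by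
  have := zmodPowersHom_intCast g hg i.val
  rwa [Int.cast_natCast, ZMod.natCast_zmod_val, zpow_natCast] at this

theorem zmodPowersHom_one {n : ℕ} {G : Type*} [Group G] (g : G) (hg : g ^ n = 1) :
    zmodPowersHom g hg (.ofAdd 1) = g := by
  simpa using zmodPowersHom_intCast g hg 1

theorem Multiplicative.zmod_hom_ext {n : ℕ} {G : Type*} [Group G]
    {f g : Multiplicative (ZMod n) →* G} (h : f (.ofAdd 1) = g (.ofAdd 1)) : f = g := by
  refine MonoidHom.ext fun i : Multiplicative (ZMod n) => ?_
  obtain ⟨k, hk⟩ := ZMod.intCast_surjective i.toAdd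
  have : i = Multiplicative.ofAdd (1 : ZMod n) ^ k := by
    rw [← ofAdd_zsmul, zsmul_one, hk, ofAdd_toAdd]
  rw [this, map_zpow, map_zpow, h]

namespace QuaternionGroup

variable {n : ℕ} {G : Type*} [Group G]

/-- The homomorphism out of a quaternion group determined by the images of its two generators. -/
def lift (a x : G) (ha : a ^ (2 * n) = 1) (hx : x ^ 2 = a ^ n) (hax : a * x = x * a⁻¹) :
    QuaternionGroup n →* G :=
  let f : Multiplicative (ZMod (2 * n)) →* G := zmodPowersHom a ha
  have hfx (i : ZMod (2 * n)) : f (.ofAdd i) * x = x * (f (.ofAdd i))⁻¹ := by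
    obtain ⟨k, rfl⟩ := ZMod.intCast_surjective i
    rw [zmodPowersHom_intCast, ← inv_zpow]
    exact ((show SemiconjBy x a⁻¹ a from hax.symm).zpow_right k).eq.symm
  have hn : f (.ofAdd n) = x ^ 2 := by
    rw [hx, ← zpow_natCast, ← zmodPowersHom_intCast a ha, Int.cast_natCast]
  { toFun
      | .a i => f (.ofAdd i)
      | .xa i => x * f (.ofAdd i)
    map_one' := map_one f
    map_mul' := by
      rintro (i | i) (j | j)
      · simp
      · simp only [a_mul_xa, ofAdd_sub, map_div, ← mul_assoc, hfx]
        rw [mul_assoc x, div_eq_mul_inv, ← map_inv, ← map_mul, ← map_mul,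
          mul_comm (Multiplicative.ofAdd j)]
      · simp [mul_assoc]
      · simp only [xa_mul_xa, ofAdd_sub, ofAdd_add, map_div, map_mul, hn]
        rw [mul_assoc x, ← mul_assoc _ x, hfx, div_eq_mul_inv, mul_assoc, ← map_inv, ← map_mul,
          mul_comm (Multiplicative.ofAdd j), map_mul, sq]
        simp only [mul_assoc] }

theorem lift_a (a x : G) (ha : a ^ (2 * n) = 1) (hx : x ^ 2 = a ^ n) (hax : a * x = x * a⁻¹)
    (i : ZMod (2 * n)) : lift a x ha hx hax (.a i) = zmodPowersHom a ha (.ofAdd i) :=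
  rfl

theorem lift_xa (a x : G) (ha : a ^ (2 * n) = 1) (hx : x ^ 2 = a ^ n) (hax : a * x = x * a⁻¹)
    (i : ZMod (2 * n)) : lift a x ha hx hax (.xa i) = x * zmodPowersHom a ha (.ofAdd i) :=
  rfl

@[simp]
theorem lift_a_one (a x : G) (ha : a ^ (2 * n) = 1) (hx : x ^ 2 = a ^ n)
    (hax : a * x = x * a⁻¹) : lift a x ha hx hax (.a 1) = a := by
  rw [lift_a, zmodPowersHom_one]

@[simp]
theorem lift_xa_zero (a x : G) (ha : a ^ (2 * n) = 1) (hx : x ^ 2 = a ^ n)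
    (hax : a * x = x * a⁻¹) : lift a x ha hx hax (.xa 0) = x := by
  simp [lift_xa]

theorem hom_ext {f g : QuaternionGroup n →* G} (ha : f (.a 1) = g (.a 1))
    (hx : f (.xa 0) = g (.xa 0)) : f = g := by
  let A : Multiplicative (ZMod (2 * n)) →* QuaternionGroup n :=
    { toFun := fun i => .a i.toAdd
      map_one' := rfl
      map_mul' := fun _ _ => rfl }
  have key : f.comp A = g.comp A := Multiplicative.zmod_hom_ext ha
  ext (i | i)
  · exact DFunLike.congr_fun key (.ofAdd i)
  · have : (xa i : QuaternionGroup n) = xa 0 * a i := by simp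
    rw [this, map_mul, map_mul, hx]
    exact congrArg (g (.xa 0) * ·) (DFunLike.congr_fun key (.ofAdd i))

end QuaternionGroup

/-- The relations satisfied by generators `a`, `j` of `Q₁₆` and an element `t` of order `6` of `T*`
in the amalgamated product of these groups along the quaternion group generated by `a ^ 2` and
`j`. -/
structure AmalgRels {G : Type*} [Group G] (a j t : G) : Prop where
  a_mul_j : a * j = j * a⁻¹
  j_sq : j ^ 2 = a ^ 4
  t_cube : t ^ 3 = a ^ 4
  t_mul_a_sq : t * a ^ 2 = j * t
  t_mul_j : t * j = a ^ 2 * j * t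

/-- The defining relations of the braid group of the sphere on four strings. -/
structure SphereBraidRels {G : Type*} [Group G] (x y z : G) : Prop where
  comm : x * z = z * x
  braid_left : x * y * x = y * x * y
  braid_right : y * z * y = z * y * z
  sphere : x * y * z ^ 2 * y * x = 1

section Relations

variable {G : Type*} [Group G]

theorem AmalgRels.a_pow_eight {a j t : G} (h : AmalgRels a j t) : a ^ 8 = 1 := by
  have h1 : a ^ 4 * j = j * (a ^ 4)⁻¹ := by
    rw [← inv_pow]
    exact ((show SemiconjBy j a⁻¹ a from h.a_mul_j.symm).pow_right 4).eq.symm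
  have h2 : a ^ 4 * j = j * a ^ 4 := by rw [← h.j_sq, ← pow_succ, ← pow_succ']
  have h3 := mul_left_cancel (h2.symm.trans h1)
  calc a ^ 8 = a ^ 4 * a ^ 4 := by rw [← pow_add]
    _ = 1 := mul_eq_one_iff_eq_inv.2 h3

theorem SphereBraidRels.prod_mul_left {x y z : G} (h : SphereBraidRels x y z) :
    x * y * z * x = y * (x * y * z) := by
  calc x * y * z * x = x * y * (x * z) := by rw [h.comm]; simp only [mul_assoc]
    _ = (x * y * x) * z := by simp only [mul_assoc]
    _ = y * (x * y * z) := by rw [h.braid_left]; simp only [mul_assoc]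

theorem SphereBraidRels.prod_mul_mid {x y z : G} (h : SphereBraidRels x y z) :
    x * y * z * y = z * (x * y * z) := by
  calc x * y * z * y = x * (y * z * y) := by simp only [mul_assoc]
    _ = (x * z) * y * z := by rw [h.braid_right]; simp only [mul_assoc]
    _ = z * (x * y * z) := by rw [h.comm]; simp only [mul_assoc]

theorem SphereBraidRels.mul_mul_inv {x y z : G} (h : SphereBraidRels x y z) :
    x * y * z * (x * y * z * x⁻¹)⁻¹ = y := by
  rw [mul_inv_rev, inv_inv, ← mul_assoc, h.prod_mul_left, mul_inv_cancel_right]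

theorem SphereBraidRels.sq_mul_mul_inv {x y z : G} (h : SphereBraidRels x y z) :
    (x * y * z) ^ 2 * (x * y * z * x⁻¹)⁻¹ * (x * y * z)⁻¹ = z := by
  rw [sq, mul_assoc (x * y * z), h.mul_mul_inv, h.prod_mul_mid, mul_inv_cancel_right]

theorem SphereBraidRels.amalgRels {x y z : G} (h : SphereBraidRels x y z) :
    AmalgRels (x * y * z) (x * y * z * x⁻¹ * (x * y * z) ^ 2 * (x * y * z * x⁻¹)⁻¹)
      (x * y * z * x⁻¹) := by
  obtain ⟨a, ha⟩ : ∃ a, a = x * y * z := ⟨_, rfl⟩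
  have hax : a * x = y * a := by rw [ha, h.prod_mul_left]
  have hay : a * y = z * a := by rw [ha, h.prod_mul_mid]
  obtain ⟨h1, h2, -, h4⟩ := h
  have hzyx : z * y * x = a⁻¹ := by
    rw [eq_inv_iff_mul_eq_one, mul_eq_one_comm, ← h4, ha]
    simp only [sq, mul_assoc]
  have haz : a * a * z = x * (a * a) := by
    have e : y * z * (a * z) = a * a := by
      calc y * z * (a * z) = y * (z * a) * z := by simp only [mul_assoc]
        _ = (y * a) * y * z := by rw [← hay]; simp only [mul_assoc]
        _ = a * (x * y * z) := by rw [← hax]; simp only [mul_assoc]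
        _ = a * a := by rw [← ha]
    calc a * a * z = a * (y * z)⁻¹ * (y * z * (a * z)) := by group
      _ = x * (a * a) := by rw [e, ha]; group
  have hxy : a * z⁻¹ = x * y := by rw [ha, mul_inv_cancel_right]
  have hzy : z * y * (a * a) = x * y := by
    calc z * y * (a * a) = z * y * x * x⁻¹ * (a * a * z) * z⁻¹ := by simp [mul_assoc]
      _ = a * z⁻¹ := by rw [hzyx, haz]; simp [mul_assoc]
      _ = x * y := hxy
  have ht : a * x⁻¹ = y⁻¹ * a := by
    rw [mul_inv_eq_iff_eq_mul, mul_assoc, hax, inv_mul_cancel_left]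
  have hay' : a * y⁻¹ = z⁻¹ * a := by
    rw [mul_inv_eq_iff_eq_mul, mul_assoc, hay, inv_mul_cancel_left]
  have ht3 : (a * x⁻¹) ^ 3 = a ^ 4 := by
    calc (a * x⁻¹) ^ 3 = y⁻¹ * (a * y⁻¹) * (a * y⁻¹) * a := by
          rw [ht]; simp only [pow_succ, pow_zero, one_mul, mul_assoc]
      _ = y⁻¹ * z⁻¹ * (a * z⁻¹) * (a * a) := by
          rw [hay']; simp only [mul_assoc]
      _ = y⁻¹ * z⁻¹ * (z * y * (a * a)) * (a * a) := by rw [hxy, hzy]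
      _ = a ^ 4 := by simp [pow_succ, mul_assoc]
  have htc : Commute (a * x⁻¹) (a ^ 4) := by
    rw [← ht3]; exact Commute.self_pow _ _
  have hac : Commute a (a ^ 4) := Commute.self_pow _ _
  have hxc : Commute x (a ^ 4) := by
    have := htc.inv_left.mul_left hac
    simpa using this
  have hD : a * (x * y * x) = x * y * x * a⁻¹ := by
    calc a * (x * y * x) = x * y * (z * x) * y * x := by rw [ha]; simp only [mul_assoc]
      _ = x * y * x * (z * y * x) := by rw [← h1]; simp only [mul_assoc]
      _ = x * y * x * a⁻¹ := by rw [hzyx]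
  have hj : a * x⁻¹ * a ^ 2 * (a * x⁻¹)⁻¹ = a ^ 3 * (x * y * x) := by
    rw [mul_inv_eq_iff_eq_mul]
    have h6 : y * a ^ 3 = a ^ 3 * z := by
      calc y * a ^ 3 = a * (x * (a * a)) := by
            rw [← mul_assoc a x, hax]; simp [pow_succ, mul_assoc]
        _ = a ^ 3 * z := by rw [← haz]; simp [pow_succ, mul_assoc]
    have h7 : y * (a ^ 3 * (x * y * x)) = a ^ 2 * y := by
      calc y * (a ^ 3 * (x * y * x)) = a ^ 3 * (z * x) * y * x := by
            rw [← mul_assoc, h6]; simp only [mul_assoc]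
        _ = a ^ 2 * (a * x) * (z * y * x) := by rw [← h1]; simp [pow_succ, mul_assoc]
        _ = a ^ 2 * y := by rw [hzyx, hax]; simp [mul_assoc]
    rw [eq_inv_mul_of_mul_eq h7, ht]
    simp [pow_succ, mul_assoc]
  rw [← ha, hj]
  refine ⟨?_, ?_, ht3, ?_, ?_⟩
  · rw [← mul_assoc, ← pow_succ', pow_succ, mul_assoc, hD]
    simp only [mul_assoc]
  · rw [← hj, conj_pow, ← pow_mul, htc.eq, mul_inv_cancel_right]
  · rw [← hj, inv_mul_cancel_right]
  · have e : a⁻¹ * (y * x * y) = x * y * x * a := by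
      rw [← h2, inv_mul_eq_iff_eq_mul, ← mul_assoc, hD, inv_mul_cancel_right]
    calc a * x⁻¹ * (a ^ 3 * (x * y * x)) = a * x⁻¹ * a ^ 4 * (a⁻¹ * (y * x * y)) := by
          rw [h2, pow_succ a 3]; simp only [mul_assoc, mul_inv_cancel_left]
      _ = a ^ 4 * a * x⁻¹ * (x * y * x * a) := by rw [htc.eq, e]; simp only [mul_assoc]
      _ = a ^ 5 * (y * x * y) * y⁻¹ * a := by simp [pow_succ, mul_assoc]
      _ = a ^ 5 * (x * y * x) * (a * x⁻¹) := by rw [← h2, ht]; simp only [mul_assoc]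
      _ = a ^ 2 * (a ^ 3 * (x * y * x)) * (a * x⁻¹) := by simp [pow_succ, mul_assoc]

theorem AmalgRels.a_mul_j_mul_a {a j t : G} (h : AmalgRels a j t) : a * j * a = j := by
  rw [h.a_mul_j, inv_mul_cancel_right]

theorem AmalgRels.j_mul_a_sq_mul_j {a j t : G} (h : AmalgRels a j t) :
    j * a ^ 2 * j = a ^ 2 := by
  calc j * a ^ 2 * j = (a ^ 2)⁻¹ * (a * (a * j * a) * a) * j := by simp [pow_succ, mul_assoc]
    _ = (a ^ 2)⁻¹ * j ^ 2 := by
      rw [h.a_mul_j_mul_a, h.a_mul_j_mul_a, mul_assoc, sq j]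
    _ = a ^ 2 := by rw [h.j_sq]; simp [pow_succ, mul_assoc]

theorem AmalgRels.t_inv_mul_a_sq {a j t : G} (h : AmalgRels a j t) :
    t⁻¹ * a ^ 2 = a ^ 2 * j * t⁻¹ := by
  rw [inv_mul_eq_iff_eq_mul, ← mul_assoc, eq_mul_inv_iff_mul_eq]
  calc a ^ 2 * t = j * (a ^ 2 * j * t) := by
        rw [← mul_assoc, ← mul_assoc, h.j_mul_a_sq_mul_j]
    _ = t * (a ^ 2 * j) := by rw [← h.t_mul_j, ← mul_assoc, ← h.t_mul_a_sq, mul_assoc]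

theorem AmalgRels.t_inv_mul_j {a j t : G} (h : AmalgRels a j t) : t⁻¹ * j = a ^ 2 * t⁻¹ := by
  rw [inv_mul_eq_iff_eq_mul, ← mul_assoc, h.t_mul_a_sq, mul_inv_cancel_right]

theorem AmalgRels.t_inv_mul_a_sq_mul_j {a j t : G} (h : AmalgRels a j t) :
    t⁻¹ * (a ^ 2 * j) = j * t⁻¹ := by
  rw [inv_mul_eq_iff_eq_mul, ← mul_assoc, h.t_mul_j, mul_inv_cancel_right]

theorem AmalgRels.t_inv_cube {a j t : G} (h : AmalgRels a j t) :
    t⁻¹ * t⁻¹ * t⁻¹ = (a ^ 4)⁻¹ := by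
  rw [← h.t_cube]
  simp only [pow_succ, pow_zero, one_mul, mul_inv_rev, mul_assoc]

theorem AmalgRels.prod_eq {a j t : G} (h : AmalgRels a j t) :
    t⁻¹ * a * (a * t⁻¹) * (a ^ 2 * t⁻¹ * a⁻¹) = a := by
  calc t⁻¹ * a * (a * t⁻¹) * (a ^ 2 * t⁻¹ * a⁻¹)
      = (t⁻¹ * a ^ 2) * (t⁻¹ * a ^ 2) * t⁻¹ * a⁻¹ := by simp only [sq, mul_assoc]
    _ = a ^ 2 * j * (t⁻¹ * (a ^ 2 * j)) * t⁻¹ * t⁻¹ * a⁻¹ := by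
      rw [h.t_inv_mul_a_sq]; simp only [mul_assoc]
    _ = a ^ 2 * j ^ 2 * (t⁻¹ * t⁻¹ * t⁻¹) * a⁻¹ := by
      rw [h.t_inv_mul_a_sq_mul_j]; simp only [sq j, mul_assoc]
    _ = a := by rw [h.j_sq, h.t_inv_cube, mul_inv_cancel_right]; simp [sq]

theorem AmalgRels.sphereBraidRels {a j t : G} (h : AmalgRels a j t) :
    SphereBraidRels (t⁻¹ * a) (a * t⁻¹) (a ^ 2 * t⁻¹ * a⁻¹) := by
  have f2 := h.t_inv_mul_a_sq_mul_j
  have f3 := h.t_inv_mul_a_sq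
  have f4 : a ^ 2 * j * a = a * j := by
    rw [sq, mul_assoc, mul_assoc, ← mul_assoc a j, h.a_mul_j_mul_a]
  have f5 := h.t_inv_cube
  have hb : (t⁻¹ * a) * (a * t⁻¹) * (t⁻¹ * a) = (a * t⁻¹) * (t⁻¹ * a) * (a * t⁻¹) := by
    calc (t⁻¹ * a) * (a * t⁻¹) * (t⁻¹ * a) = (t⁻¹ * a ^ 2) * (t⁻¹ * t⁻¹) * a := by
          simp only [sq, mul_assoc]
      _ = a ^ 2 * j * (t⁻¹ * t⁻¹ * t⁻¹) * a := by rw [f3]; simp only [mul_assoc]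
      _ = (a ^ 2 * j * a) * (t⁻¹ * t⁻¹ * t⁻¹) := by rw [f5]; simp [pow_succ, mul_assoc]
      _ = a * j * (t⁻¹ * t⁻¹ * t⁻¹) := by rw [f4]
      _ = a * (t⁻¹ * (t⁻¹ * a ^ 2)) * t⁻¹ := by
          rw [f3, ← mul_assoc t⁻¹, f2]; simp only [mul_assoc]
      _ = (a * t⁻¹) * (t⁻¹ * a) * (a * t⁻¹) := by simp only [sq, mul_assoc]
  refine ⟨?_, hb, ?_, ?_⟩
  · calc t⁻¹ * a * (a ^ 2 * t⁻¹ * a⁻¹) = (t⁻¹ * a ^ 2) * a * t⁻¹ * a⁻¹ := by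
          simp only [sq, mul_assoc]
      _ = a ^ 2 * t⁻¹ * (a ^ 2 * j * a) * t⁻¹ * a⁻¹ := by
          rw [f3, mul_assoc (a ^ 2) j, ← f2]; simp only [mul_assoc]
      _ = a ^ 2 * t⁻¹ * a * t⁻¹ * a ^ 2 * j * a⁻¹ := by
          rw [f4, mul_assoc _ _ t⁻¹, mul_assoc a, ← f2]; simp only [mul_assoc]
      _ = a ^ 2 * t⁻¹ * a⁻¹ * (a ^ 2 * t⁻¹) * a ^ 2 * j * a⁻¹ := by simp [sq, mul_assoc]
      _ = a ^ 2 * t⁻¹ * a⁻¹ * t⁻¹ * (j * a ^ 2 * j) * a⁻¹ := by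
          rw [← h.t_inv_mul_j]; simp only [mul_assoc]
      _ = a ^ 2 * t⁻¹ * a⁻¹ * (t⁻¹ * a) := by
          rw [h.j_mul_a_sq_mul_j]; simp [sq, mul_assoc]
  · calc a * t⁻¹ * (a ^ 2 * t⁻¹ * a⁻¹) * (a * t⁻¹)
        = a * ((t⁻¹ * a) * (a * t⁻¹) * (t⁻¹ * a)) * a⁻¹ := by simp [sq, mul_assoc]
      _ = _ := by rw [hb]; simp [sq, mul_assoc]
  · calc t⁻¹ * a * (a * t⁻¹) * (a ^ 2 * t⁻¹ * a⁻¹) ^ 2 * (a * t⁻¹) * (t⁻¹ * a)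
        = t⁻¹ * a * (a * t⁻¹) * (a ^ 2 * t⁻¹ * a⁻¹) *
            (a ^ 2 * (t⁻¹ * t⁻¹ * t⁻¹) * a) := by
          simp [pow_succ, mul_assoc]
      _ = 1 := by rw [h.prod_eq, f5]; simp [pow_succ, mul_assoc]

end Relations

/-- The automorphism of order three of the quaternion group cyclically permuting `i`, `j`, `k`. -/
def quaternionRotation : MulAut (QuaternionGroup 2) :=
  let f : QuaternionGroup 2 →* QuaternionGroup 2 :=
    QuaternionGroup.lift (.xa 0) (.xa 3) (by decide) (by decide) (by decide)
  have hf : f.comp (f.comp f) = .id _ := QuaternionGroup.hom_ext (by decide) (by decide)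
  f.toMulEquiv (f.comp f) hf hf

theorem quaternionRotation_a_one : quaternionRotation (.a 1) = .xa 0 := by decide

theorem quaternionRotation_xa_zero : quaternionRotation (.xa 0) = .xa 3 := by decide

theorem quaternionRotation_pow_three : quaternionRotation ^ 3 = 1 := by
  ext x
  revert x
  decide

/-- The semidirect product `Q₈ ⋊ ℤ/3`, a model of the binary tetrahedral group. -/
abbrev BinaryTetrahedral : Type :=
  QuaternionGroup 2 ⋊[zmodPowersHom quaternionRotation quaternionRotation_pow_three]
    Multiplicative (ZMod 3)

namespace BinaryTetrahedral

variable {G : Type*} [Group G]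

/-- The homomorphism out of the binary tetrahedral group determined by a homomorphism on `Q₈` and a
compatible element of order dividing `3`. -/
def lift (f : QuaternionGroup 2 →* G) (u : G) (hu : u ^ 3 = 1)
    (ha : f (.xa 0) = u * f (.a 1) * u⁻¹) (hx : f (.xa 3) = u * f (.xa 0) * u⁻¹) :
    BinaryTetrahedral →* G :=
  SemidirectProduct.lift f (zmodPowersHom u hu) (by
    have key : f.comp quaternionRotation.toMonoidHom = (MulAut.conj u).toMonoidHom.comp f := by
      apply QuaternionGroup.hom_ext
      · simpa [quaternionRotation_a_one] using ha
      · simpa [quaternionRotation_xa_zero] using hx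
    have pow (k : ℕ) : f.comp (quaternionRotation ^ k).toMonoidHom =
        (MulAut.conj (u ^ k)).toMonoidHom.comp f := by
      induction k with
      | zero => ext; simp
      | succ k ih =>
        ext q
        have h1 : f ((quaternionRotation ^ k) (quaternionRotation q)) =
            u ^ k * f (quaternionRotation q) * (u ^ k)⁻¹ :=
          DFunLike.congr_fun ih (quaternionRotation q)
        have h2 : f (quaternionRotation q) = u * f q * u⁻¹ := DFunLike.congr_fun key q
        change f ((quaternionRotation ^ (k + 1)) q) = u ^ (k + 1) * f q * (u ^ (k + 1))⁻¹
        rw [pow_succ, MulAut.mul_apply, h1, h2, pow_succ]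
        simp only [mul_inv_rev, mul_assoc]
    intro g
    have h1 := zmodPowersHom_apply quaternionRotation quaternionRotation_pow_three g.toAdd
    have h2 := zmodPowersHom_apply u hu g.toAdd
    rw [ofAdd_toAdd] at h1 h2
    rw [h1, h2, pow])

theorem lift_inl (f : QuaternionGroup 2 →* G) (u : G) (hu : u ^ 3 = 1)
    (ha : f (.xa 0) = u * f (.a 1) * u⁻¹) (hx : f (.xa 3) = u * f (.xa 0) * u⁻¹)
    (q : QuaternionGroup 2) : lift f u hu ha hx (SemidirectProduct.inl q) = f q :=
  SemidirectProduct.lift_inl ..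

theorem lift_inr_one (f : QuaternionGroup 2 →* G) (u : G) (hu : u ^ 3 = 1)
    (ha : f (.xa 0) = u * f (.a 1) * u⁻¹) (hx : f (.xa 3) = u * f (.xa 0) * u⁻¹) :
    lift f u hu ha hx (SemidirectProduct.inr (.ofAdd 1)) = u :=
  (SemidirectProduct.lift_inr ..).trans (zmodPowersHom_one u hu)

theorem hom_ext {f g : BinaryTetrahedral →* G}
    (ha : f (SemidirectProduct.inl (.a 1)) = g (SemidirectProduct.inl (.a 1)))
    (hx : f (SemidirectProduct.inl (.xa 0)) = g (SemidirectProduct.inl (.xa 0)))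
    (hu : f (SemidirectProduct.inr (.ofAdd 1)) = g (SemidirectProduct.inr (.ofAdd 1))) : f = g :=
  SemidirectProduct.hom_ext (QuaternionGroup.hom_ext ha hx) (Multiplicative.zmod_hom_ext hu)

end BinaryTetrahedral

open scoped MatrixGroups

/-- The image in `SL(2, ℤ/3)` of the first generator of `Q₈`. -/
def slI : SL(2, ZMod 3) := ⟨!![0, -1; 1, 0], by decide⟩

/-- The image in `SL(2, ℤ/3)` of the second generator of `Q₈`. -/
def slJ : SL(2, ZMod 3) := ⟨!![1, 1; 1, -1], by decide⟩

/-- An element of order `3` permuting the order `4` subgroups of `Q₈` by conjugation. -/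
def slU : SL(2, ZMod 3) := ⟨!![1, 1; 0, 1], by decide⟩

/-- The embedding of `Q₈` in `SL(2, ℤ/3)`. -/
def quaternionToSL : QuaternionGroup 2 →* SL(2, ZMod 3) :=
  QuaternionGroup.lift slI slJ (by decide) (by decide) (by decide)

/-- The embedding of `Q₈` in `Q₁₆`. -/
def quaternionToDicyclic : QuaternionGroup 2 →* QuaternionGroup 4 :=
  QuaternionGroup.lift (.a 2) (.xa 0) (by decide) (by decide) (by decide)

theorem quaternionToDicyclic_injective : Function.Injective quaternionToDicyclic := by
  rw [injective_iff_map_eq_one]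
  decide

/-- The homomorphism `Q₈ ⋊ ℤ/3 →* SL(2, ℤ/3)`. -/
def binaryTetrahedralToSL : BinaryTetrahedral →* SL(2, ZMod 3) :=
  BinaryTetrahedral.lift quaternionToSL slU (by decide) (by decide) (by decide)

theorem binaryTetrahedralToSL_injective : Function.Injective binaryTetrahedralToSL := by
  rw [injective_iff_map_eq_one]
  rintro ⟨q, c⟩
  revert q c
  decide +kernel

theorem binaryTetrahedralToSL_surjective : Function.Surjective binaryTetrahedralToSL := by
  have : ∀ A : Matrix (Fin 2) (Fin 2) (ZMod 3), A.det = 1 → ∃ q c,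
      (binaryTetrahedralToSL ⟨q, c⟩ : SL(2, ZMod 3)).1 = A := by
    decide +kernel
  rintro ⟨A, hA⟩
  obtain ⟨q, c, h⟩ := this A hA
  exact ⟨⟨q, c⟩, Subtype.ext h⟩

/-- The isomorphism of `Q₈ ⋊ ℤ/3` with `SL(2, ℤ/3)`. -/
noncomputable def binaryTetrahedralEquivSL : BinaryTetrahedral ≃* SL(2, ZMod 3) :=
  MulEquiv.ofBijective binaryTetrahedralToSL
    ⟨binaryTetrahedralToSL_injective, binaryTetrahedralToSL_surjective⟩

theorem quaternionToSL_injective : Function.Injective quaternionToSL := by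
  rw [injective_iff_map_eq_one]
  decide

theorem binaryTetrahedralEquivSL_inl (q : QuaternionGroup 2) :
    binaryTetrahedralEquivSL (SemidirectProduct.inl q) = quaternionToSL q :=
  BinaryTetrahedral.lift_inl quaternionToSL slU (by decide) (by decide) (by decide) q

theorem binaryTetrahedralEquivSL_inr_one :
    binaryTetrahedralEquivSL (SemidirectProduct.inr (.ofAdd 1)) = slU :=
  BinaryTetrahedral.lift_inr_one quaternionToSL slU (by decide) (by decide) (by decide)

theorem quaternionToSL_a_one : quaternionToSL (.a 1) = slI :=
  QuaternionGroup.lift_a_one ..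

theorem quaternionToSL_xa_zero : quaternionToSL (.xa 0) = slJ :=
  QuaternionGroup.lift_xa_zero ..

theorem sl_hom_ext {G : Type*} [Group G] {f g : SL(2, ZMod 3) →* G} (hI : f slI = g slI)
    (hJ : f slJ = g slJ) (hU : f slU = g slU) : f = g := by
  have : f.comp binaryTetrahedralEquivSL.toMonoidHom =
      g.comp binaryTetrahedralEquivSL.toMonoidHom := by
    apply BinaryTetrahedral.hom_ext
    · simpa [binaryTetrahedralEquivSL_inl, quaternionToSL_a_one] using hI
    · simpa [binaryTetrahedralEquivSL_inl, quaternionToSL_xa_zero] using hJ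
    · simpa [binaryTetrahedralEquivSL_inr_one] using hU
  exact (MonoidHom.cancel_right binaryTetrahedralEquivSL.surjective).1 this

namespace AmalgRels

variable {G : Type*} [Group G] {a j t : G}

/-- The homomorphism `Q₈ →* G` determined by elements satisfying the relations. -/
def quaternionHom (h : AmalgRels a j t) : QuaternionGroup 2 →* G :=
  QuaternionGroup.lift (a ^ 2) j (by rw [← pow_mul, h.a_pow_eight])
    (by rw [← pow_mul, h.j_sq]) (by
      rw [← inv_pow]
      exact ((show SemiconjBy j a⁻¹ a from h.a_mul_j.symm).pow_right 2).eq.symm)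

/-- The homomorphism `Q₁₆ →* G` determined by elements satisfying the relations. -/
def dicyclicHom (h : AmalgRels a j t) : QuaternionGroup 4 →* G :=
  QuaternionGroup.lift a j h.a_pow_eight h.j_sq h.a_mul_j

theorem quaternionHom_a_one (h : AmalgRels a j t) : h.quaternionHom (.a 1) = a ^ 2 :=
  QuaternionGroup.lift_a_one ..

theorem quaternionHom_xa_zero (h : AmalgRels a j t) : h.quaternionHom (.xa 0) = j :=
  QuaternionGroup.lift_xa_zero ..

theorem dicyclicHom_a_one (h : AmalgRels a j t) : h.dicyclicHom (.a 1) = a :=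
  QuaternionGroup.lift_a_one ..

theorem dicyclicHom_xa_zero (h : AmalgRels a j t) : h.dicyclicHom (.xa 0) = j :=
  QuaternionGroup.lift_xa_zero ..

theorem dicyclicHom_comp (h : AmalgRels a j t) :
    h.dicyclicHom.comp quaternionToDicyclic = h.quaternionHom := by
  apply QuaternionGroup.hom_ext
  · have : quaternionToDicyclic (.a 1) = .a 1 ^ 2 := by decide
    rw [MonoidHom.comp_apply, this, map_pow, dicyclicHom_a_one, quaternionHom_a_one]
  · have : quaternionToDicyclic (.xa 0) = .xa 0 := by decide
    rw [MonoidHom.comp_apply, this, dicyclicHom_xa_zero, quaternionHom_xa_zero]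

theorem commute_t (h : AmalgRels a j t) : Commute (a ^ 4) t := by
  rw [← h.t_cube]
  exact Commute.pow_self t 3

theorem commute_j (h : AmalgRels a j t) : Commute (a ^ 4) j := by
  rw [← h.j_sq]
  exact Commute.pow_self j 2

theorem a_pow_four_mul_self (h : AmalgRels a j t) : a ^ 4 * a ^ 4 = 1 := by
  rw [← pow_add, h.a_pow_eight]

theorem a_pow_four_mul_t_cube (h : AmalgRels a j t) : (a ^ 4 * t) ^ 3 = 1 := by
  rw [h.commute_t.mul_pow, h.t_cube, ← pow_succ, ← pow_mul, show 4 * (3 + 1) = 8 * 2 from rfl,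
    pow_mul, h.a_pow_eight, one_pow]

/-- The homomorphism `T* →* G` determined by elements satisfying the relations. -/
noncomputable def slHom (h : AmalgRels a j t) : SL(2, ZMod 3) →* G :=
  (BinaryTetrahedral.lift h.quaternionHom (a ^ 4 * t) h.a_pow_four_mul_t_cube
    (by
      rw [quaternionHom_a_one, quaternionHom_xa_zero, eq_mul_inv_iff_mul_eq, mul_assoc (a ^ 4),
        h.t_mul_a_sq, ← mul_assoc, ← mul_assoc, h.commute_j.eq])
    (by
      have : (.xa 3 : QuaternionGroup 2) = .a 1 * .xa 0 := by decide
      rw [this, map_mul, quaternionHom_a_one, quaternionHom_xa_zero, eq_mul_inv_iff_mul_eq,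
        mul_assoc (a ^ 4), h.t_mul_j, ← mul_assoc, ← mul_assoc]
      congr 1
      rw [mul_assoc, ← h.commute_j.eq, ← mul_assoc, ← mul_assoc, ← pow_add, ← pow_add])).comp
    binaryTetrahedralEquivSL.symm.toMonoidHom

theorem slHom_comp (h : AmalgRels a j t) : h.slHom.comp quaternionToSL = h.quaternionHom := by
  ext q
  rw [MonoidHom.comp_apply, ← binaryTetrahedralEquivSL_inl]
  simp [slHom, BinaryTetrahedral.lift_inl]

theorem slHom_slU (h : AmalgRels a j t) : h.slHom slU = a ^ 4 * t := by
  rw [← binaryTetrahedralEquivSL_inr_one]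
  simp [slHom, BinaryTetrahedral.lift_inr_one]

theorem slHom_slI (h : AmalgRels a j t) : h.slHom slI = a ^ 2 := by
  rw [← quaternionToSL_a_one, ← MonoidHom.comp_apply, slHom_comp, quaternionHom_a_one]

theorem slHom_sq_mul (h : AmalgRels a j t) : h.slHom (slI ^ 2 * slU) = t := by
  rw [map_mul, map_pow, slHom_slI, slHom_slU, ← pow_mul, ← mul_assoc, h.a_pow_four_mul_self,
    one_mul]

end AmalgRels

/-- The amalgamated product `Q₁₆ *_{Q₈} T*`. -/
abbrev DicyclicAmalgTetrahedral : Type :=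
  Monoid.PushoutI (amalgMaps quaternionToDicyclic quaternionToSL)

namespace DicyclicAmalgTetrahedral

/-- The inclusion of `Q₁₆`. -/
def inl : QuaternionGroup 4 →* DicyclicAmalgTetrahedral :=
  Monoid.PushoutI.of (φ := amalgMaps quaternionToDicyclic quaternionToSL) true

/-- The inclusion of `T*`. -/
def inr : SL(2, ZMod 3) →* DicyclicAmalgTetrahedral :=
  Monoid.PushoutI.of (φ := amalgMaps quaternionToDicyclic quaternionToSL) false

theorem inl_eq_inr (q : QuaternionGroup 2) :
    inl (quaternionToDicyclic q) = inr (quaternionToSL q) :=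
  (Monoid.PushoutI.of_apply_eq_base (amalgMaps quaternionToDicyclic quaternionToSL) true q).trans
    (Monoid.PushoutI.of_apply_eq_base
      (amalgMaps quaternionToDicyclic quaternionToSL) false q).symm

theorem inr_slI : inr slI = inl (.a 1) ^ 2 := by
  rw [← quaternionToSL_a_one, ← inl_eq_inr, ← map_pow]
  exact congrArg inl (by decide)

theorem inr_slJ : inr slJ = inl (.xa 0) := by
  rw [← quaternionToSL_xa_zero, ← inl_eq_inr]
  exact congrArg inl (by decide)

theorem amalgRels : AmalgRels (inl (.a 1)) (inl (.xa 0)) (inr (slI ^ 2 * slU)) where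
  a_mul_j := by
    rw [← map_inv, ← map_mul, ← map_mul]
    exact congrArg inl (by decide)
  j_sq := by
    rw [← map_pow, ← map_pow]
    exact congrArg inl (by decide)
  t_cube := by
    have e : inl (.a 1) ^ 4 = (inl (.a 1) ^ 2) ^ 2 := pow_mul _ 2 2
    rw [e, ← inr_slI, ← map_pow, ← map_pow]
    exact congrArg inr (by decide)
  t_mul_a_sq := by
    rw [← inr_slI, ← inr_slJ, ← map_mul, ← map_mul]
    exact congrArg inr (by decide)
  t_mul_j := by
    rw [← inr_slI, ← inr_slJ, ← map_mul, ← map_mul, ← map_mul]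
    exact congrArg inr (by decide)

variable {G : Type*} [Group G] {a j t : G}

/-- The homomorphism out of the amalgamated product determined by elements satisfying the
relations. -/
noncomputable def lift (h : AmalgRels a j t) : DicyclicAmalgTetrahedral →* G :=
  Monoid.PushoutI.lift
    (fun
      | true => h.dicyclicHom
      | false => h.slHom)
    h.quaternionHom
    (fun
      | true => h.dicyclicHom_comp
      | false => h.slHom_comp)

theorem lift_inl (h : AmalgRels a j t) (q : QuaternionGroup 4) :
    lift h (inl q) = h.dicyclicHom q :=
  Monoid.PushoutI.lift_of ..

theorem lift_inr (h : AmalgRels a j t) (q : SL(2, ZMod 3)) : lift h (inr q) = h.slHom q :=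
  Monoid.PushoutI.lift_of ..

theorem hom_ext {f g : DicyclicAmalgTetrahedral →* G} (ha : f (inl (.a 1)) = g (inl (.a 1)))
    (hj : f (inl (.xa 0)) = g (inl (.xa 0)))
    (ht : f (inr (slI ^ 2 * slU)) = g (inr (slI ^ 2 * slU))) : f = g := by
  have hI : f (inr slI) = g (inr slI) := by
    rw [inr_slI, map_pow, map_pow, ha]
  have hU : f (inr slU) = g (inr slU) := by
    simpa [hI] using ht
  apply Monoid.PushoutI.hom_ext_nonempty
  rintro (_ | _)
  · exact sl_hom_ext (f := f.comp inr) (g := g.comp inr) hI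
      (by simpa [inr_slJ] using hj) hU
  · exact QuaternionGroup.hom_ext (f := f.comp inl) (g := g.comp inl) ha hj

end DicyclicAmalgTetrahedral

namespace B4S2

theorem sphereBraidRels_σ : SphereBraidRels (σ 0) (σ 1) (σ 2) where
  comm := mul_inv_eq_one.1 (PresentedGroup.one_of_mem (rels := sphereBraidRels) (.inl rfl))
  braid_left := mul_inv_eq_one.1
    (PresentedGroup.one_of_mem (rels := sphereBraidRels) (.inr (.inl rfl)))
  braid_right := mul_inv_eq_one.1
    (PresentedGroup.one_of_mem (rels := sphereBraidRels) (.inr (.inr (.inl rfl))))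
  sphere := PresentedGroup.one_of_mem (rels := sphereBraidRels) (.inr (.inr (.inr rfl)))

variable {G : Type*} [Group G] {x y z : G}

/-- The homomorphism out of the sphere braid group determined by elements satisfying the
relations. -/
def lift (h : SphereBraidRels x y z) : B4S2 →* G :=
  PresentedGroup.toGroup (f := ![x, y, z]) (by
    rintro r (rfl | rfl | rfl | rfl)
    · rw [map_mul, map_inv, mul_inv_eq_one]
      simpa using h.comm
    · rw [map_mul, map_inv, mul_inv_eq_one]
      simpa using h.braid_left
    · rw [map_mul, map_inv, mul_inv_eq_one]
      simpa using h.braid_right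
    · simpa using h.sphere)

theorem lift_σ_zero (h : SphereBraidRels x y z) : lift h (σ 0) = x :=
  PresentedGroup.toGroup.of _

theorem lift_σ_one (h : SphereBraidRels x y z) : lift h (σ 1) = y :=
  PresentedGroup.toGroup.of _

theorem lift_σ_two (h : SphereBraidRels x y z) : lift h (σ 2) = z :=
  PresentedGroup.toGroup.of _

theorem hom_ext {f g : B4S2 →* G} (h₀ : f (σ 0) = g (σ 0)) (h₁ : f (σ 1) = g (σ 1))
    (h₂ : f (σ 2) = g (σ 2)) : f = g := by
  apply PresentedGroup.ext
  intro i
  fin_cases i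
  exacts [h₀, h₁, h₂]

end B4S2

open DicyclicAmalgTetrahedral in
/-- The isomorphism between the sphere braid group and the amalgamated product. -/
noncomputable def b4S2EquivAmalg : B4S2 ≃* DicyclicAmalgTetrahedral :=
  MonoidHom.toMulEquiv (B4S2.lift amalgRels.sphereBraidRels)
    (lift B4S2.sphereBraidRels_σ.amalgRels)
    (by
      have h := B4S2.sphereBraidRels_σ
      have ha : lift h.amalgRels (inl (.a 1)) = σ 0 * σ 1 * σ 2 := by
        rw [lift_inl, AmalgRels.dicyclicHom_a_one]
      have ht : lift h.amalgRels (inr (slI ^ 2 * slU)) = σ 0 * σ 1 * σ 2 * (σ 0)⁻¹ := by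
        rw [lift_inr, AmalgRels.slHom_sq_mul]
      apply B4S2.hom_ext
      · rw [MonoidHom.comp_apply, B4S2.lift_σ_zero, map_mul (lift _), map_inv, ha, ht,
          mul_inv_rev (σ 0 * σ 1 * σ 2), inv_inv, inv_mul_cancel_right, MonoidHom.id_apply]
      · rw [MonoidHom.comp_apply, B4S2.lift_σ_one, map_mul (lift _), map_inv, ha, ht,
          h.mul_mul_inv, MonoidHom.id_apply]
      · rw [MonoidHom.comp_apply, B4S2.lift_σ_two, map_mul (lift _), map_mul (lift _),
          map_inv, map_inv, map_pow (lift _), ha, ht, h.sq_mul_mul_inv, MonoidHom.id_apply])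
    (by
      have ha : B4S2.lift amalgRels.sphereBraidRels (σ 0 * σ 1 * σ 2) = inl (.a 1) := by
        rw [map_mul (B4S2.lift _), map_mul (B4S2.lift _), B4S2.lift_σ_zero, B4S2.lift_σ_one,
          B4S2.lift_σ_two, amalgRels.prod_eq]
      have ht : B4S2.lift amalgRels.sphereBraidRels (σ 0 * σ 1 * σ 2 * (σ 0)⁻¹) =
          inr (slI ^ 2 * slU) := by
        rw [map_mul (B4S2.lift _), ha, map_inv, B4S2.lift_σ_zero, mul_inv_rev, inv_inv,
          mul_inv_cancel_left]
      apply DicyclicAmalgTetrahedral.hom_ext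
      · rw [MonoidHom.comp_apply, lift_inl, AmalgRels.dicyclicHom_a_one, ha, MonoidHom.id_apply]
      · rw [MonoidHom.comp_apply, lift_inl, AmalgRels.dicyclicHom_xa_zero,
          map_mul (B4S2.lift _), map_mul (B4S2.lift _), map_inv, map_pow (B4S2.lift _), ha, ht,
          amalgRels.t_mul_a_sq, mul_inv_cancel_right, MonoidHom.id_apply]
      · rw [MonoidHom.comp_apply, lift_inr, AmalgRels.slHom_sq_mul, ht, MonoidHom.id_apply])

/-- `B₄(S²)` is isomorphic to the amalgamated free product
`Q₁₆ *_{Q₈} T*`, i.e. the pushout of a pair of injective homomorphisms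
`Q₈ →* Q₁₆` and `Q₈ →* T*`. -/
theorem b4S2_iso_amalgamatedProduct :
    ∃ (φ₁ : QuaternionGroup 2 →* QuaternionGroup 4)
      (φ₂ : QuaternionGroup 2 →* Matrix.SpecialLinearGroup (Fin 2) (ZMod 3)),
      Function.Injective φ₁ ∧ Function.Injective φ₂ ∧
      Nonempty (B4S2 ≃* Monoid.PushoutI (amalgMaps φ₁ φ₂)) := by
  exact ⟨quaternionToDicyclic, quaternionToSL, quaternionToDicyclic_injective,
    quaternionToSL_injective, ⟨b4S2EquivAmalg⟩⟩
end

section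
/- Let K = {g ∈ B₄(S²) : for every subgroup H of B₄(S²) with H ≤ Q and |H| = 4, the conjugate g H g⁻¹ equals H}, the kernel of the conjugation action of B₄(S²) on the set of cyclic subgroups of Q of order 4. Then K is a subgroup of B₄(S²) isomorphic to the direct product (QuaternionGroup 2) × FreeGroup (Fin 2), i.e. Q₈ times a free group of rank 2, a basis of the free factor being given by x = α₀²Δ₄σ₁² and y = Δ₄σ₂². -/
/-- The element `α₀ = σ₁σ₂σ₃` of `B₄(S²)`. -/
def α₀ : B4S2 := σ 0 * σ 1 * σ 2

/-- The half-twist `Δ₄ = σ₁σ₂σ₃σ₁σ₂σ₁` of `B₄(S²)`. -/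
def Δ₄ : B4S2 := σ 0 * σ 1 * σ 2 * σ 0 * σ 1 * σ 0

/-- The normal subgroup `Q = ⟨α₀², Δ₄⟩` of `B₄(S²)`, isomorphic to `Q₈`. -/
def Qsub : Subgroup B4S2 := Subgroup.closure {α₀ ^ 2, Δ₄}

/-- The kernel `K` of the conjugation action of `B₄(S²)` on the set of (cyclic) subgroups
of `Q` of order `4`. -/
def Kconj : Subgroup B4S2 where
  carrier := {g | ∀ H : Subgroup B4S2, H ≤ Qsub → Nat.card H = 4 →
      Subgroup.map (MulAut.conj g).toMonoidHom H = H}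
  one_mem' := by
    intro H _ _
    convert Subgroup.map_id H
    ext x
    simp
  mul_mem' := by
    intro a b ha hb H hH hc
    have h1 := ha H hH hc
    have h2 := hb H hH hc
    have key : Subgroup.map (MulAut.conj (a * b)).toMonoidHom H =
        Subgroup.map (MulAut.conj a).toMonoidHom
          (Subgroup.map (MulAut.conj b).toMonoidHom H) := by
      rw [Subgroup.map_map]
      congr 1
      ext x
      simp [MulAut.conj_apply, mul_assoc]
    rw [key, h2, h1]
  inv_mem' := by
    intro a ha H hH hc
    have h := ha H hH hc
    conv_lhs => rw [← h]
    rw [Subgroup.map_map]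
    convert Subgroup.map_id H
    ext x
    simp [MulAut.conj_apply, mul_assoc]

open scoped Pointwise

section Relations

theorem σ_zero_comm_two : σ 0 * σ 2 = σ 2 * σ 0 :=
  mul_inv_eq_one.mp <|
    PresentedGroup.one_of_mem (rels := sphereBraidRels) (by simp [sphereBraidRels])

theorem σ_braid_zero_one : σ 0 * σ 1 * σ 0 = σ 1 * σ 0 * σ 1 :=
  mul_inv_eq_one.mp <|
    PresentedGroup.one_of_mem (rels := sphereBraidRels) (by simp [sphereBraidRels])

theorem σ_braid_one_two : σ 1 * σ 2 * σ 1 = σ 2 * σ 1 * σ 2 :=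
  mul_inv_eq_one.mp <|
    PresentedGroup.one_of_mem (rels := sphereBraidRels) (by simp [sphereBraidRels])

theorem σ_sphere : σ 0 * σ 1 * σ 2 ^ 2 * σ 1 * σ 0 = 1 :=
  PresentedGroup.one_of_mem (rels := sphereBraidRels)
    (x := FreeGroup.of 0 * FreeGroup.of 1 * FreeGroup.of 2 ^ 2 * FreeGroup.of 1 * FreeGroup.of 0)
    (by simp [sphereBraidRels])

theorem α₀_inv : α₀⁻¹ = σ 2 * σ 1 * σ 0 := by
  rw [inv_eq_iff_mul_eq_one, ← σ_sphere, α₀]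
  simp only [pow_two, mul_assoc]

theorem semiconjBy_α₀_σ_zero : SemiconjBy α₀ (σ 0) (σ 1) := by
  unfold SemiconjBy α₀
  rw [mul_assoc _ _ (σ 0), ← σ_zero_comm_two, ← mul_assoc, σ_braid_zero_one]
  simp only [mul_assoc]

theorem semiconjBy_α₀_σ_one : SemiconjBy α₀ (σ 1) (σ 2) := by
  unfold SemiconjBy α₀
  rw [mul_assoc (σ 0), mul_assoc (σ 0), σ_braid_one_two, ← mul_assoc, ← mul_assoc,
    σ_zero_comm_two]
  simp only [mul_assoc]

theorem semiconjBy_half_twist_σ_zero : SemiconjBy (σ 0 * σ 1 * σ 0) (σ 0) (σ 1) := by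
  unfold SemiconjBy
  nth_rewrite 1 [σ_braid_zero_one]
  simp only [mul_assoc]

theorem semiconjBy_half_twist_σ_one : SemiconjBy (σ 0 * σ 1 * σ 0) (σ 1) (σ 0) := by
  unfold SemiconjBy
  nth_rewrite 2 [σ_braid_zero_one]
  simp only [mul_assoc]

theorem Δ₄_eq_α₀_mul : Δ₄ = α₀ * (σ 0 * σ 1 * σ 0) := by
  simp only [Δ₄, α₀, mul_assoc]

theorem Δ₄_eq_mul_α₀_inv : Δ₄ = σ 0 * σ 1 * σ 0 * α₀⁻¹ := by
  rw [α₀_inv, Δ₄, mul_assoc _ (σ 2) (σ 0), ← σ_zero_comm_two]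
  simp only [mul_assoc]

theorem semiconjBy_Δ₄_σ_zero : SemiconjBy Δ₄ (σ 0) (σ 2) := by
  rw [Δ₄_eq_α₀_mul]
  exact semiconjBy_α₀_σ_one.mul_left semiconjBy_half_twist_σ_zero

theorem semiconjBy_Δ₄_σ_one : SemiconjBy Δ₄ (σ 1) (σ 1) := by
  rw [Δ₄_eq_α₀_mul]
  exact semiconjBy_α₀_σ_zero.mul_left semiconjBy_half_twist_σ_one

theorem semiconjBy_Δ₄_σ_two : SemiconjBy Δ₄ (σ 2) (σ 0) := by
  rw [Δ₄_eq_mul_α₀_inv]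
  exact semiconjBy_half_twist_σ_one.mul_left semiconjBy_α₀_σ_one.inv_symm_left

theorem semiconjBy_Δ₄_α₀ : SemiconjBy Δ₄ α₀ α₀⁻¹ := by
  rw [α₀_inv, α₀]
  exact (semiconjBy_Δ₄_σ_zero.mul_right semiconjBy_Δ₄_σ_one).mul_right semiconjBy_Δ₄_σ_two

theorem semiconjBy_Δ₄_α₀_sq : SemiconjBy Δ₄ (α₀ ^ 2) (α₀ ^ 2)⁻¹ := by
  rw [← inv_pow]
  exact semiconjBy_Δ₄_α₀.pow_right 2

theorem α₀_sq_mul_σ_zero : α₀ ^ 2 * σ 0 = Δ₄ * σ 2 := by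
  rw [Δ₄_eq_α₀_mul, pow_two, mul_assoc, mul_assoc, mul_assoc _ _ (σ 2), σ_zero_comm_two, α₀]
  simp only [mul_assoc]

theorem α₀_sq_eq : α₀ ^ 2 = Δ₄ * (σ 2 * (σ 0)⁻¹) := by
  rw [← mul_assoc, ← α₀_sq_mul_σ_zero, mul_inv_cancel_right]

theorem σ_two_eq : σ 2 = Δ₄⁻¹ * α₀ ^ 2 * σ 0 := by
  rw [α₀_sq_eq]
  group

theorem α₀_sq_sq : (α₀ ^ 2) ^ 2 = Δ₄ ^ 2 := by
  have h : SemiconjBy Δ₄ (σ 0 * (σ 2)⁻¹) (σ 2 * (σ 0)⁻¹) :=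
    semiconjBy_Δ₄_σ_zero.mul_right semiconjBy_Δ₄_σ_two.inv_right
  rw [pow_two (α₀ ^ 2), pow_two Δ₄, α₀_sq_eq, mul_assoc, ← mul_assoc _ Δ₄, ← h.eq]
  group

theorem α₀_sq_pow_four : (α₀ ^ 2) ^ 4 = 1 := by
  have h : Δ₄ * (α₀ ^ 2) ^ 2 = ((α₀ ^ 2)⁻¹) ^ 2 * Δ₄ := (semiconjBy_Δ₄_α₀_sq.pow_right 2).eq
  rw [α₀_sq_sq, ← pow_succ', pow_succ, mul_left_inj, inv_pow, α₀_sq_sq] at h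
  rw [pow_mul (α₀ ^ 2) 2 2, α₀_sq_sq, pow_two]
  nth_rewrite 1 [h]
  exact inv_mul_cancel _

theorem Δ₄_pow_four : Δ₄ ^ 4 = 1 := by
  rw [pow_mul Δ₄ 2 2, ← α₀_sq_sq, ← pow_mul, α₀_sq_pow_four]

theorem α₀_sq_sq_inv : ((α₀ ^ 2) ^ 2)⁻¹ = (α₀ ^ 2) ^ 2 := by
  rw [inv_eq_iff_mul_eq_one, ← pow_add, α₀_sq_pow_four]

theorem Δ₄_mul_α₀_sq : Δ₄ * α₀ ^ 2 = α₀ ^ 2 * Δ₄⁻¹ := by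
  have h : (α₀ ^ 2)⁻¹ = α₀ ^ 2 * (Δ₄ ^ 2)⁻¹ := by
    rw [← α₀_sq_sq, α₀_sq_sq_inv, inv_eq_iff_mul_eq_one, ← pow_succ' (α₀ ^ 2),
      ← pow_succ' (α₀ ^ 2), α₀_sq_pow_four]
  rw [semiconjBy_Δ₄_α₀_sq.eq, h]
  group

theorem semiconjBy_α₀_sq_Δ₄ : SemiconjBy (α₀ ^ 2) Δ₄ Δ₄⁻¹ := by
  simpa using (show SemiconjBy (α₀ ^ 2) Δ₄⁻¹ Δ₄ from Δ₄_mul_α₀_sq.symm).inv_right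

theorem semiconjBy_σ_zero_Δ₄ : SemiconjBy (σ 0) Δ₄ (α₀ ^ 2) := by
  rw [SemiconjBy, ← semiconjBy_Δ₄_σ_two.eq, α₀_sq_mul_σ_zero]

theorem semiconjBy_σ_zero_α₀_sq : SemiconjBy (σ 0) (α₀ ^ 2) Δ₄⁻¹ := by
  have h : σ 2 = σ 0 * (Δ₄⁻¹ * α₀ ^ 2) := by
    rw [α₀_sq_eq, inv_mul_cancel_left, ← mul_assoc, σ_zero_comm_two, mul_inv_cancel_right]
  have h' : α₀ ^ 2 * Δ₄ = Δ₄ * (α₀ ^ 2)⁻¹ := (semiconjBy_Δ₄_α₀_sq.inv_right.eq.trans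
    (by rw [inv_inv])).symm
  have h'' : SemiconjBy (σ 0) (α₀ ^ 2)⁻¹ Δ₄ := by
    rw [SemiconjBy, semiconjBy_Δ₄_σ_zero.eq, h, mul_assoc, mul_assoc Δ₄⁻¹, h', inv_mul_cancel_left]
  simpa using h''.inv_right

theorem half_twist_eq_Δ₄_mul : σ 0 * σ 1 * σ 0 = Δ₄ * α₀ := by
  rw [Δ₄_eq_mul_α₀_inv, inv_mul_cancel_right]

theorem half_twist_sq : σ 0 * σ 1 * σ 0 * (σ 0 * σ 1 * σ 0) = Δ₄ ^ 2 := by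
  have h : σ 0 * σ 1 * σ 0 = α₀⁻¹ * Δ₄ := by rw [Δ₄_eq_α₀_mul, inv_mul_cancel_left]
  nth_rewrite 1 [half_twist_eq_Δ₄_mul]
  rw [h, mul_assoc, mul_inv_cancel_left, pow_two]

theorem semiconjBy_half_twist_Δ₄ :
    SemiconjBy (σ 0 * σ 1 * σ 0) Δ₄ ((α₀ ^ 2)⁻¹ * Δ₄) := by
  have h : Δ₄ * α₀⁻¹ = α₀ * Δ₄ := by simpa using semiconjBy_Δ₄_α₀.inv_right.eq
  rw [half_twist_eq_Δ₄_mul, SemiconjBy, semiconjBy_Δ₄_α₀.eq, mul_assoc, mul_assoc,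
    ← mul_assoc Δ₄ α₀⁻¹, h]
  group

theorem semiconjBy_σ_one_α₀_sq : SemiconjBy (σ 1) (α₀ ^ 2) (Δ₄⁻¹ * (α₀ ^ 2)⁻¹) := by
  have h₁ : SemiconjBy (σ 0)⁻¹ (α₀ ^ 2) Δ₄ := semiconjBy_σ_zero_Δ₄.inv_symm_left
  have h₂ : SemiconjBy (σ 0)⁻¹ Δ₄ (α₀ ^ 2)⁻¹ := by
    simpa using semiconjBy_σ_zero_α₀_sq.inv_symm_left.inv_right
  have h := ((h₁.inv_right.mul_right h₂).mul_left semiconjBy_half_twist_Δ₄).mul_left h₁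
  rwa [show (σ 0)⁻¹ * (σ 0 * σ 1 * σ 0) * (σ 0)⁻¹ = σ 1 by group] at h

theorem semiconjBy_σ_one_Δ₄ : SemiconjBy (σ 1) Δ₄ Δ₄ :=
  semiconjBy_Δ₄_σ_one.eq.symm

theorem σ_one_mul_σ_zero_sq_mul_σ_one :
    σ 1 * σ 0 ^ 2 * σ 1 = ((α₀ ^ 2)⁻¹) ^ 2 * (σ 0 ^ 2)⁻¹ := by
  have h : SemiconjBy (σ 0)⁻¹ (Δ₄ ^ 2) (((α₀ ^ 2)⁻¹) ^ 2) := by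
    simpa using semiconjBy_σ_zero_α₀_sq.inv_symm_left.inv_right.pow_right 2
  calc σ 1 * σ 0 ^ 2 * σ 1
      = (σ 0)⁻¹ * (σ 0 * σ 1 * σ 0 * (σ 0 * σ 1 * σ 0)) * (σ 0)⁻¹ := by
        rw [pow_two]
        group
    _ = _ := by
        rw [half_twist_sq, h.eq]
        group

theorem σ_zero_conj_σ_one_sq :
    σ 0 * σ 1 ^ 2 * (σ 0)⁻¹ = (σ 1 ^ 2)⁻¹ * (σ 1 * σ 0 ^ 2 * σ 1) := by
  have h : SemiconjBy (σ 1 * σ 0) (σ 1) (σ 0) := by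
    rw [SemiconjBy, ← mul_assoc, σ_braid_zero_one]
  rw [mul_inv_eq_iff_eq_mul,
    eq_inv_mul_of_mul_eq ((mul_assoc _ _ _).symm.trans (h.pow_right 2).eq)]
  group

end Relations

section FreeFactor

theorem commute_free_generators_α₀_sq :
    Commute (α₀ ^ 2 * Δ₄ * σ 0 ^ 2) (α₀ ^ 2) ∧ Commute (Δ₄ * σ 1 ^ 2) (α₀ ^ 2) := by
  have hΔ : SemiconjBy Δ₄ (α₀ ^ 2)⁻¹ (α₀ ^ 2) := by
    simpa using semiconjBy_Δ₄_α₀_sq.inv_right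
  have h₀ : SemiconjBy (σ 0 ^ 2) (α₀ ^ 2) (α₀ ^ 2)⁻¹ := by
    rw [pow_two (σ 0)]
    exact semiconjBy_σ_zero_Δ₄.inv_right.mul_left semiconjBy_σ_zero_α₀_sq
  have h₁ : SemiconjBy (σ 1 ^ 2) (α₀ ^ 2) (α₀ ^ 2)⁻¹ := by
    rw [pow_two (σ 1)]
    have h := (semiconjBy_σ_one_Δ₄.inv_right.mul_right
      semiconjBy_σ_one_α₀_sq.inv_right).mul_left semiconjBy_σ_one_α₀_sq
    rwa [mul_inv_rev, inv_inv, inv_inv, ← hΔ.eq, inv_mul_cancel_left] at h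
  exact ⟨SemiconjBy.mul_left (SemiconjBy.mul_left (Commute.refl _) hΔ) h₀, hΔ.mul_left h₁⟩

theorem commute_free_generators_Δ₄ :
    Commute (α₀ ^ 2 * Δ₄ * σ 0 ^ 2) Δ₄ ∧ Commute (Δ₄ * σ 1 ^ 2) Δ₄ := by
  have h₀ : SemiconjBy (σ 0 ^ 2) Δ₄ Δ₄⁻¹ := by
    rw [pow_two (σ 0)]
    exact semiconjBy_σ_zero_α₀_sq.mul_left semiconjBy_σ_zero_Δ₄
  have hα : SemiconjBy (α₀ ^ 2) Δ₄⁻¹ Δ₄ := Δ₄_mul_α₀_sq.symm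
  exact ⟨(hα.mul_left (Commute.refl Δ₄).inv_right).mul_left h₀,
    (Commute.refl Δ₄).mul_left (Commute.pow_left semiconjBy_σ_one_Δ₄ 2)⟩

end FreeFactor

section FiniteQuotient

/-- Invertible matrices over `𝔽₇` satisfying the defining relations of `B₄(S²)`. -/
def sphereBraidMatrix : Fin 3 → (Matrix (Fin 2) (Fin 2) (ZMod 7))ˣ :=
  ![⟨!![0, 1; 3, 1], !![2, 5; 1, 0], by decide, by decide⟩,
    ⟨!![0, 3; 1, 1], !![2, 1; 5, 0], by decide, by decide⟩,
    ⟨!![1, 6; 4, 0], !![0, 2; 6, 2], by decide, by decide⟩]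

/-- A representation of `B₄(S²)` over `𝔽₇` which is faithful on `Q`. -/
def sphereBraidRep : B4S2 →* (Matrix (Fin 2) (Fin 2) (ZMod 7))ˣ :=
  PresentedGroup.toGroup (f := sphereBraidMatrix) <| by
    rintro r (rfl | rfl | rfl | rfl) <;>
      simp only [map_mul, map_inv, map_pow, FreeGroup.lift_apply_of] <;> decide

theorem sphereBraidRep_σ (i : Fin 3) : sphereBraidRep (σ i) = sphereBraidMatrix i :=
  PresentedGroup.toGroup.of _

end FiniteQuotient

section Quaternion

/-- The homomorphism from the quaternion group determined by a pair of elements satisfying the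
defining relations of `Q₈`. -/
def QuaternionGroup.liftQ8 {G : Type*} [Group G] (u v : G) (hv : v ^ 4 = 1) (huv : u ^ 2 = v ^ 2)
    (hc : SemiconjBy u v v⁻¹) : QuaternionGroup 2 →* G :=
  have hadd (i j : ZMod 4) : v ^ (i + j).val = v ^ i.val * v ^ j.val := by
    rw [ZMod.val_add, ← pow_add, ← pow_eq_pow_mod _ hv]
  have hsub (i j : ZMod 4) : v ^ (j - i).val = (v ^ i.val)⁻¹ * v ^ j.val := by
    rw [eq_inv_mul_iff_mul_eq, ← hadd, add_sub_cancel]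
  have hcomm (k : ℕ) : v ^ k * u = u * (v ^ k)⁻¹ := by
    simpa using (hc.inv_right.pow_right k).eq.symm
  MonoidHom.mk'
    (fun
      | .a i => v ^ (i : ZMod 4).val
      | .xa i => u * v ^ (i : ZMod 4).val) <| by
    rintro (i | i) (j | j)
    · exact hadd i j
    · change u * v ^ (j - i : ZMod 4).val = v ^ (i : ZMod 4).val * (u * v ^ (j : ZMod 4).val)
      rw [hsub, ← mul_assoc, ← mul_assoc, hcomm]
    · change u * v ^ (i + j : ZMod 4).val = u * v ^ (i : ZMod 4).val * v ^ (j : ZMod 4).val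
      rw [hadd, mul_assoc]
    · change v ^ (2 + j - i : ZMod 4).val =
        u * v ^ (i : ZMod 4).val * (u * v ^ (j : ZMod 4).val)
      rw [add_sub_assoc, hadd, hsub, mul_assoc, ← mul_assoc _ u, hcomm, mul_assoc, ← mul_assoc u u,
        ← pow_two u, huv]
      rfl

/-- The isomorphism of `Q₈` with `Q`, as a homomorphism into `B₄(S²)`. -/
def quaternionHom : QuaternionGroup 2 →* B4S2 :=
  QuaternionGroup.liftQ8 (α₀ ^ 2) Δ₄ Δ₄_pow_four α₀_sq_sq semiconjBy_α₀_sq_Δ₄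

theorem quaternionHom_a (i : ZMod 4) : quaternionHom (.a i) = Δ₄ ^ i.val := rfl

theorem quaternionHom_xa (i : ZMod 4) : quaternionHom (.xa i) = α₀ ^ 2 * Δ₄ ^ i.val := rfl

theorem range_quaternionHom : quaternionHom.range = Qsub := by
  have hu : α₀ ^ 2 ∈ Qsub := Subgroup.subset_closure (by simp)
  have hv : Δ₄ ∈ Qsub := Subgroup.subset_closure (by simp)
  refine le_antisymm ?_ ?_
  · rintro _ ⟨i | i, rfl⟩
    · exact pow_mem hv _
    · exact mul_mem hu (pow_mem hv _)
  · rw [Qsub, Subgroup.closure_le]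
    rintro _ (rfl | rfl)
    · exact ⟨.xa 0, by simp [quaternionHom_xa]⟩
    · exact ⟨.a 1, pow_one Δ₄⟩

theorem quaternionHom_injective : Function.Injective quaternionHom := by
  rw [injective_iff_map_eq_one]
  have h (q : QuaternionGroup 2) : sphereBraidRep (quaternionHom q) = 1 → q = 1 := by
    rcases q with i | i
    · change sphereBraidRep (Δ₄ ^ (i : ZMod 4).val) = 1 → _
      simp only [Δ₄, map_pow, map_mul, sphereBraidRep_σ]
      revert i
      decide
    · change sphereBraidRep (α₀ ^ 2 * Δ₄ ^ (i : ZMod 4).val) = 1 → _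
      simp only [Δ₄, α₀, map_pow, map_mul, sphereBraidRep_σ]
      revert i
      decide
  exact fun q hq => h q (by rw [hq, map_one])

theorem card_Qsub : Nat.card Qsub = 8 := by
  rw [← range_quaternionHom,
    ← Nat.card_congr (MonoidHom.ofInjective quaternionHom_injective).toEquiv,
    Nat.card_eq_fintype_card, QuaternionGroup.card]

end Quaternion

section PingPong

open Complex

/-- The permutation of `ℂ²` given by `i` times the matrix `!![1, 1; 0, 1]`. -/
def upperShear : Equiv.Perm (ℂ × ℂ) where
  toFun p := (I * (p.1 + p.2), I * p.2)
  invFun p := (-I * (p.1 - p.2), -I * p.2)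
  left_inv p := by
    ext
    · linear_combination -p.1 * I_sq
    · linear_combination -p.2 * I_sq
  right_inv p := by
    ext
    · linear_combination -p.1 * I_sq
    · linear_combination -p.2 * I_sq

/-- The permutation of `ℂ²` given by `i` times the matrix `!![1, 0; -1, 1]`. -/
def lowerShear : Equiv.Perm (ℂ × ℂ) where
  toFun p := (I * p.1, I * (p.2 - p.1))
  invFun p := (-I * p.1, -I * (p.2 + p.1))
  left_inv p := by
    ext
    · linear_combination -p.1 * I_sq
    · linear_combination -p.2 * I_sq
  right_inv p := by
    ext
    · linear_combination -p.1 * I_sq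
    · linear_combination -p.2 * I_sq

theorem upperShear_apply (p : ℂ × ℂ) : upperShear p = (I * (p.1 + p.2), I * p.2) := rfl

theorem lowerShear_apply (p : ℂ × ℂ) : lowerShear p = (I * p.1, I * (p.2 - p.1)) := rfl

theorem shear_braid :
    upperShear * lowerShear * upperShear = lowerShear * upperShear * lowerShear := by
  ext p <;> simp only [Equiv.Perm.mul_apply, upperShear_apply, lowerShear_apply] <;> ring

theorem shear_half_twist_apply (p : ℂ × ℂ) :
    (upperShear * lowerShear * upperShear) p = (-I * p.2, I * p.1) := by
  ext <;> simp only [Equiv.Perm.mul_apply, upperShear_apply, lowerShear_apply]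
  · linear_combination I * p.2 * I_sq
  · linear_combination -I * p.1 * I_sq

theorem shear_half_twist_sq : (upperShear * lowerShear * upperShear) ^ 2 = 1 := by
  ext p <;> simp only [pow_two, Equiv.Perm.mul_apply _ (_ * _), shear_half_twist_apply,
    Equiv.Perm.one_apply]
  · linear_combination -p.1 * I_sq
  · linear_combination -p.2 * I_sq

/-- The action of `B₄(S²)` on `ℂ²` through which `B₄(S²) / Q` acts as the modular group, up to
scalars. -/
def modularRep : B4S2 →* Equiv.Perm (ℂ × ℂ) :=
  PresentedGroup.toGroup (f := ![upperShear, lowerShear, upperShear]) <| by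
    rintro r (rfl | rfl | rfl | rfl) <;>
      simp only [map_mul, map_inv, map_pow, FreeGroup.lift_apply_of, mul_inv_eq_one]
    · rfl
    · exact shear_braid
    · exact shear_braid.symm
    · rw [← shear_half_twist_sq, pow_two, pow_two]
      rfl

theorem modularRep_σ (i : Fin 3) :
    modularRep (σ i) = ![upperShear, lowerShear, upperShear] i :=
  PresentedGroup.toGroup.of _

theorem modularRep_α₀_sq : modularRep (α₀ ^ 2) = 1 := by
  rw [map_pow, ← shear_half_twist_sq]
  simp only [α₀, map_mul, modularRep_σ]
  rfl

theorem modularRep_Δ₄ : modularRep Δ₄ = 1 := by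
  rw [← shear_half_twist_sq, pow_two]
  simp only [Δ₄_eq_α₀_mul, α₀, map_mul, modularRep_σ]
  rfl

theorem modularRep_quaternionHom (q : QuaternionGroup 2) : modularRep (quaternionHom q) = 1 := by
  rcases q with i | i
  · rw [quaternionHom_a, map_pow, modularRep_Δ₄, one_pow]
  · rw [quaternionHom_xa, map_mul, map_pow _ Δ₄, modularRep_Δ₄, modularRep_α₀_sq, one_pow, one_mul]

theorem modularRep_σ_zero_sq_zpow (n : ℤ) (p : ℂ × ℂ) :
    (modularRep (σ 0 ^ 2) ^ n) p = ((-1) ^ n * (p.1 + 2 * n * p.2), (-1) ^ n * p.2) := by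
  have h (p : ℂ × ℂ) : modularRep (σ 0 ^ 2) p = (-(p.1 + 2 * p.2), -p.2) := by
    rw [map_pow, modularRep_σ]
    ext <;> simp [pow_two, upperShear_apply]
    · linear_combination (p.1 + 2 * p.2) * I_sq
    · linear_combination p.2 * I_sq
  have h' (p : ℂ × ℂ) : (modularRep (σ 0 ^ 2))⁻¹ p = (-(p.1 - 2 * p.2), -p.2) := by
    rw [Equiv.Perm.inv_eq_iff_eq, h]
    ext <;> simp
  induction n generalizing p with
  | zero => simp
  | succ n ih =>
    rw [zpow_add_one, Equiv.Perm.mul_apply, h, ih, zpow_add_one₀ (by norm_num)]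
    ext <;> push_cast <;> ring
  | pred n ih =>
    rw [zpow_sub_one, Equiv.Perm.mul_apply, h', ih, zpow_sub_one₀ (by norm_num)]
    ext <;> push_cast <;> ring

theorem modularRep_σ_one_sq_zpow (n : ℤ) (p : ℂ × ℂ) :
    (modularRep (σ 1 ^ 2) ^ n) p = ((-1) ^ n * p.1, (-1) ^ n * (p.2 - 2 * n * p.1)) := by
  have h (p : ℂ × ℂ) : modularRep (σ 1 ^ 2) p = (-p.1, -(p.2 - 2 * p.1)) := by
    rw [map_pow, modularRep_σ]
    ext <;> simp [pow_two, lowerShear_apply]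
    · linear_combination p.1 * I_sq
    · linear_combination (p.2 - 2 * p.1) * I_sq
  have h' (p : ℂ × ℂ) : (modularRep (σ 1 ^ 2))⁻¹ p = (-p.1, -(p.2 + 2 * p.1)) := by
    rw [Equiv.Perm.inv_eq_iff_eq, h]
    ext <;> simp
  induction n generalizing p with
  | zero => simp
  | succ n ih =>
    rw [zpow_add_one, Equiv.Perm.mul_apply, h, ih, zpow_add_one₀ (by norm_num)]
    ext <;> push_cast <;> ring
  | pred n ih =>
    rw [zpow_sub_one, Equiv.Perm.mul_apply, h', ih, zpow_sub_one₀ (by norm_num)]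
    ext <;> push_cast <;> ring

theorem norm_lt_norm_add_two_mul_int {p q : ℂ} (h : ‖p‖ < ‖q‖) {n : ℤ} (hn : n ≠ 0) :
    ‖q‖ < ‖p + 2 * n * q‖ := by
  have hn' : (1 : ℝ) ≤ |(n : ℝ)| := by exact_mod_cast Int.one_le_abs hn
  have h₁ : ‖2 * n * q‖ = 2 * |(n : ℝ)| * ‖q‖ := by simp
  have h₂ : ‖2 * n * q‖ ≤ ‖p + 2 * n * q‖ + ‖p‖ := by
    simpa using norm_sub_le (p + 2 * n * q) p
  nlinarith [norm_nonneg q]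

theorem FreeGroup.lift_injective_of_zpow_ping_pong {ι G α : Type*} [Nontrivial ι] [Group G]
    [MulAction G α] (a : ι → G) (X : ι → Set α) (hne : ∀ i, (X i).Nonempty)
    (hdisj : Pairwise (Function.onFun Disjoint X))
    (hpp : ∀ i j, i ≠ j → ∀ n : ℤ, n ≠ 0 → a i ^ n • X j ⊆ X i) :
    Function.Injective (FreeGroup.lift a) := by
  have hlift : FreeGroup.lift a =
      (Monoid.CoprodI.lift fun i => FreeGroup.lift fun _ => a i).comp
        (@freeGroupEquivCoprodI ι).toMonoidHom := by
    ext i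
    simp
  rw [hlift, MonoidHom.coe_comp]
  refine Function.Injective.comp ?_ (MulEquiv.injective freeGroupEquivCoprodI)
  refine Monoid.CoprodI.lift_injective_of_ping_pong _ (.inr ⟨Classical.arbitrary ι, ?_⟩) X hne
    hdisj fun i j hij => FreeGroup.freeGroupUnitEquivInt.forall_congr_left.mpr fun n hn => ?_
  · rw [FreeGroup.freeGroupUnitEquivInt.cardinal_eq, Cardinal.mk_denumerable]
    exact Cardinal.natCast_le_aleph0
  · change FreeGroup.lift (fun _ => a i) (FreeGroup.of () ^ n) • X j ⊆ X i
    rw [map_zpow, FreeGroup.lift_apply_of]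
    refine hpp i j hij n ?_
    rintro rfl
    exact hn (zpow_zero _)

theorem lift_σ_sq_modularRep_injective :
    Function.Injective
      (FreeGroup.lift ![modularRep (σ 0 ^ 2), modularRep (σ 1 ^ 2)]) := by
  refine FreeGroup.lift_injective_of_zpow_ping_pong (α := ℂ × ℂ) _
    ![{p | ‖p.2‖ < ‖p.1‖}, {p | ‖p.1‖ < ‖p.2‖}] ?_ ?_ ?_
  · exact Fin.forall_fin_two.mpr ⟨⟨(1, 0), by simp⟩, ⟨(0, 1), by simp⟩⟩
  · have h : Disjoint {p : ℂ × ℂ | ‖p.2‖ < ‖p.1‖} {p : ℂ × ℂ | ‖p.1‖ < ‖p.2‖} :=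
      Set.disjoint_left.mpr fun p (hp : ‖p.2‖ < ‖p.1‖) => hp.not_gt
    intro i j hij
    fin_cases i <;> fin_cases j <;> simp at hij
    exacts [h, h.symm]
  · intro i j hij n hn
    rintro _ ⟨p, hp, rfl⟩
    fin_cases i <;> fin_cases j <;> simp at hij
    · change (modularRep (σ 0 ^ 2) ^ n) p ∈ {p : ℂ × ℂ | ‖p.2‖ < ‖p.1‖}
      rw [modularRep_σ_zero_sq_zpow]
      simpa using norm_lt_norm_add_two_mul_int hp hn
    · change (modularRep (σ 1 ^ 2) ^ n) p ∈ {p : ℂ × ℂ | ‖p.1‖ < ‖p.2‖}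
      rw [modularRep_σ_one_sq_zpow]
      simpa [sub_eq_add_neg] using norm_lt_norm_add_two_mul_int hp (neg_ne_zero.mpr hn)

end PingPong

section FreeFactor

/-- The homomorphism from the free group of rank two with image generated by `α₀²Δ₄σ₁²` and
`Δ₄σ₂²`. -/
def freeFactorHom : FreeGroup (Fin 2) →* B4S2 :=
  FreeGroup.lift ![α₀ ^ 2 * Δ₄ * σ 0 ^ 2, Δ₄ * σ 1 ^ 2]

theorem freeFactorHom_of_zero :
    freeFactorHom (FreeGroup.of 0) = α₀ ^ 2 * Δ₄ * σ 0 ^ 2 :=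
  FreeGroup.lift_apply_of

theorem freeFactorHom_of_one : freeFactorHom (FreeGroup.of 1) = Δ₄ * σ 1 ^ 2 :=
  FreeGroup.lift_apply_of

theorem modularRep_comp_freeFactorHom_injective :
    Function.Injective (modularRep.comp freeFactorHom) := by
  convert lift_σ_sq_modularRep_injective
  ext i : 1
  fin_cases i
  · change modularRep (freeFactorHom (.of 0)) = _
    rw [freeFactorHom_of_zero, map_mul, map_mul, modularRep_α₀_sq, modularRep_Δ₄, one_mul, one_mul]
    exact FreeGroup.lift_apply_of.symm
  · change modularRep (freeFactorHom (.of 1)) = _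
    rw [freeFactorHom_of_one, map_mul, modularRep_Δ₄, one_mul]
    exact FreeGroup.lift_apply_of.symm

theorem freeFactorHom_mem_centralizer (w : FreeGroup (Fin 2)) :
    freeFactorHom w ∈ Subgroup.centralizer (Qsub : Set B4S2) := by
  suffices h : freeFactorHom.range ≤ Subgroup.centralizer (Qsub : Set B4S2) from h ⟨w, rfl⟩
  rw [freeFactorHom, FreeGroup.range_lift_eq_closure, Subgroup.closure_le, Qsub,
    Subgroup.centralizer_closure]
  rintro _ ⟨i, rfl⟩
  rw [SetLike.mem_coe, Subgroup.mem_centralizer_iff]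
  rintro _ (rfl | rfl) <;> fin_cases i
  exacts [commute_free_generators_α₀_sq.1.eq.symm, commute_free_generators_α₀_sq.2.eq.symm,
    commute_free_generators_Δ₄.1.eq.symm, commute_free_generators_Δ₄.2.eq.symm]

theorem commute_quaternionHom_freeFactorHom (q : QuaternionGroup 2) (w : FreeGroup (Fin 2)) :
    Commute (quaternionHom q) (freeFactorHom w) :=
  Subgroup.mem_centralizer_iff.mp (freeFactorHom_mem_centralizer w) _
    (range_quaternionHom ▸ ⟨q, rfl⟩)

/-- The embedding of `Q₈ × F₂` in `B₄(S²)`. -/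
def quaternionProdFreeHom : QuaternionGroup 2 × FreeGroup (Fin 2) →* B4S2 :=
  quaternionHom.noncommCoprod freeFactorHom commute_quaternionHom_freeFactorHom

theorem quaternionProdFreeHom_injective : Function.Injective quaternionProdFreeHom := by
  refine (MonoidHom.noncommCoprod_injective _ _ _).mpr ⟨quaternionHom_injective,
    Function.Injective.of_comp modularRep_comp_freeFactorHom_injective, ?_⟩
  rw [Subgroup.disjoint_def]
  rintro _ ⟨q, rfl⟩ ⟨w, hw⟩
  rw [← hw, (injective_iff_map_eq_one _).mp modularRep_comp_freeFactorHom_injective w, map_one]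
  rw [MonoidHom.comp_apply, hw, modularRep_quaternionHom]

end FreeFactor

section Kernel

theorem mem_Kconj_of_conj_mem {g : B4S2} (h : ∀ H : Subgroup B4S2, H ≤ Qsub → Nat.card H = 4 →
    ∀ x ∈ H, g * x * g⁻¹ ∈ H) : g ∈ Kconj := by
  intro H hH hc
  have : Finite H := Nat.finite_of_card_ne_zero (by omega)
  refine Subgroup.eq_of_le_of_card_ge ?_ ?_
  · rintro _ ⟨x, hx, rfl⟩
    exact h H hH hc x hx
  · rw [Subgroup.card_map_of_injective (MulAut.conj g).injective]

theorem Qsub_le_Kconj : Qsub ≤ Kconj := by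
  refine fun g hg => mem_Kconj_of_conj_mem fun H hH hc x hx => ?_
  have hcard : Nat.card (H.subgroupOf Qsub) = 4 := by
    rw [← hc]
    exact Nat.card_congr (Subgroup.subgroupOfEquivOfLe hH).toEquiv
  have hindex : (H.subgroupOf Qsub).index = 2 := by
    have := (H.subgroupOf Qsub).card_mul_index
    rw [hcard, card_Qsub] at this
    omega
  exact (Subgroup.normal_of_index_eq_two hindex).conj_mem ⟨x, hH hx⟩ hx ⟨g, hg⟩

theorem range_freeFactorHom_le_Kconj : freeFactorHom.range ≤ Kconj := by
  rintro _ ⟨w, rfl⟩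
  refine mem_Kconj_of_conj_mem fun H hH _ x hx => ?_
  rwa [← Subgroup.mem_centralizer_iff.mp (freeFactorHom_mem_centralizer w) x (hH hx),
    mul_inv_cancel_right]

/-- The subgroup of `B₄(S²)` generated by `Q` and the squares of `σ₁` and `σ₂`. -/
def squaresSubgroup : Subgroup B4S2 :=
  Subgroup.closure {α₀ ^ 2, Δ₄, σ 0 ^ 2, σ 1 ^ 2}

theorem α₀_sq_mem_squaresSubgroup : α₀ ^ 2 ∈ squaresSubgroup :=
  Subgroup.subset_closure (by simp)

theorem Δ₄_mem_squaresSubgroup : Δ₄ ∈ squaresSubgroup :=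
  Subgroup.subset_closure (by simp)

theorem σ_zero_sq_mem_squaresSubgroup : σ 0 ^ 2 ∈ squaresSubgroup :=
  Subgroup.subset_closure (by simp)

theorem σ_one_sq_mem_squaresSubgroup : σ 1 ^ 2 ∈ squaresSubgroup :=
  Subgroup.subset_closure (by simp)

theorem Subgroup.mem_normalizer_closure_of_sq_mem {G : Type*} [Group G] {s : Set G} {g : G}
    (hg : g ^ 2 ∈ Subgroup.closure s) (h : ∀ x ∈ s, g * x * g⁻¹ ∈ Subgroup.closure s) :
    g ∈ Subgroup.normalizer (Subgroup.closure s : Set G) := by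
  have hconj : ∀ x ∈ Subgroup.closure s, g * x * g⁻¹ ∈ Subgroup.closure s := by
    have : Subgroup.closure s ≤ (Subgroup.closure s).comap (MulAut.conj g).toMonoidHom :=
      (Subgroup.closure_le _).mpr h
    exact this
  rw [Subgroup.mem_normalizer_iff]
  refine fun x => ⟨hconj x, fun hx => ?_⟩
  have := mul_mem (mul_mem (inv_mem hg) (hconj _ hx)) hg
  convert this using 1
  rw [pow_two]
  group

theorem σ_one_mul_σ_zero_sq_mul_σ_one_mem :
    σ 1 * σ 0 ^ 2 * σ 1 ∈ squaresSubgroup := by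
  rw [σ_one_mul_σ_zero_sq_mul_σ_one]
  exact mul_mem (pow_mem (inv_mem α₀_sq_mem_squaresSubgroup) 2)
    (inv_mem σ_zero_sq_mem_squaresSubgroup)

instance normal_squaresSubgroup : squaresSubgroup.Normal := by
  have hu := α₀_sq_mem_squaresSubgroup
  have hv := Δ₄_mem_squaresSubgroup
  have h₀ : σ 0 ∈ Subgroup.normalizer (squaresSubgroup : Set B4S2) := by
    refine Subgroup.mem_normalizer_closure_of_sq_mem σ_zero_sq_mem_squaresSubgroup ?_
    rintro _ (rfl | rfl | rfl | rfl)
    · rw [semiconjBy_σ_zero_α₀_sq.eq, mul_inv_cancel_right]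
      exact inv_mem hv
    · rwa [semiconjBy_σ_zero_Δ₄.eq, mul_inv_cancel_right]
    · rw [(Commute.self_pow (σ 0) 2).eq, mul_inv_cancel_right]
      exact σ_zero_sq_mem_squaresSubgroup
    · rw [σ_zero_conj_σ_one_sq]
      exact mul_mem (inv_mem σ_one_sq_mem_squaresSubgroup) σ_one_mul_σ_zero_sq_mul_σ_one_mem
  have h₁ : σ 1 ∈ Subgroup.normalizer (squaresSubgroup : Set B4S2) := by
    refine Subgroup.mem_normalizer_closure_of_sq_mem σ_one_sq_mem_squaresSubgroup ?_
    rintro _ (rfl | rfl | rfl | rfl)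
    · rw [semiconjBy_σ_one_α₀_sq.eq, mul_inv_cancel_right]
      exact mul_mem (inv_mem hv) (inv_mem hu)
    · rwa [semiconjBy_σ_one_Δ₄.eq, mul_inv_cancel_right]
    · have h : σ 1 * σ 0 ^ 2 * (σ 1)⁻¹ = σ 1 * σ 0 ^ 2 * σ 1 * (σ 1 ^ 2)⁻¹ := by
        rw [pow_two (σ 1)]
        group
      rw [h]
      exact mul_mem σ_one_mul_σ_zero_sq_mul_σ_one_mem (inv_mem σ_one_sq_mem_squaresSubgroup)
    · rw [(Commute.self_pow (σ 1) 2).eq, mul_inv_cancel_right]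
      exact σ_one_sq_mem_squaresSubgroup
  have hle := Subgroup.le_normalizer (H := squaresSubgroup)
  rw [← Subgroup.normalizer_eq_top_iff, eq_top_iff]
  refine fun g _ => PresentedGroup.generated_by _ _ (fun i => ?_) g
  fin_cases i
  · exact h₀
  · exact h₁
  · change σ 2 ∈ _
    rw [σ_two_eq]
    exact mul_mem (mul_mem (inv_mem (hle hv)) (hle hu)) h₀

theorem squaresSubgroup_le_range : squaresSubgroup ≤ quaternionProdFreeHom.range := by
  rw [quaternionProdFreeHom, MonoidHom.noncommCoprod_range, range_quaternionHom]
  have hu : α₀ ^ 2 ∈ Qsub ⊔ freeFactorHom.range :=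
    Subgroup.mem_sup_left (Subgroup.subset_closure (by simp))
  have hv : Δ₄ ∈ Qsub ⊔ freeFactorHom.range :=
    Subgroup.mem_sup_left (Subgroup.subset_closure (by simp))
  rw [squaresSubgroup, Subgroup.closure_le]
  rintro _ (rfl | rfl | rfl | rfl)
  · exact hu
  · exact hv
  · exact (mul_mem_cancel_left (mul_mem hu hv)).mp
      (Subgroup.mem_sup_right ⟨.of 0, freeFactorHom_of_zero⟩)
  · exact (mul_mem_cancel_left hv).mp
      (Subgroup.mem_sup_right ⟨.of 1, freeFactorHom_of_one⟩)

theorem range_quaternionProdFreeHom_le_Kconj : quaternionProdFreeHom.range ≤ Kconj := by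
  rw [quaternionProdFreeHom, MonoidHom.noncommCoprod_range, range_quaternionHom]
  exact sup_le Qsub_le_Kconj range_freeFactorHom_le_Kconj

/-- Coset representatives of the subgroup generated by `Q` and the squares of `σ₁` and `σ₂`. -/
def cosetReps : List B4S2 := [1, σ 0, σ 1, σ 0 * σ 1, σ 1 * σ 0, σ 0 * σ 1 * σ 0]

theorem exists_mem_cosetReps (g : B4S2) :
    ∃ t ∈ cosetReps, (t : B4S2 ⧸ squaresSubgroup) = g := by
  let A : B4S2 ⧸ squaresSubgroup := (σ 0 : B4S2)
  let B : B4S2 ⧸ squaresSubgroup := (σ 1 : B4S2)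
  have hA : A * A = 1 := by
    rw [← pow_two]
    exact (QuotientGroup.eq_one_iff _).mpr σ_zero_sq_mem_squaresSubgroup
  have hB : B * B = 1 := by
    rw [← pow_two]
    exact (QuotientGroup.eq_one_iff _).mpr σ_one_sq_mem_squaresSubgroup
  have hAB : A * B * A = B * A * B := congrArg (QuotientGroup.mk' squaresSubgroup) σ_braid_zero_one
  have hC : ((σ 2 : B4S2) : B4S2 ⧸ squaresSubgroup) = A := by
    rw [σ_two_eq, QuotientGroup.mk_mul, (QuotientGroup.eq_one_iff _).mpr
      (mul_mem (inv_mem Δ₄_mem_squaresSubgroup) α₀_sq_mem_squaresSubgroup), one_mul]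
  let P (x : B4S2 ⧸ squaresSubgroup) : Prop :=
    x = 1 ∨ x = A ∨ x = B ∨ x = A * B ∨ x = B * A ∨ x = A * B * A
  have hPA (x) (hx : P x) : P (A * x) := by
    rcases hx with rfl | rfl | rfl | rfl | rfl | rfl <;>
      simp [P, ← mul_assoc, hA]
  have hPB (x) (hx : P x) : P (B * x) := by
    rcases hx with rfl | rfl | rfl | rfl | rfl | rfl
    · simp [P]
    · simp [P]
    · simp [P, hB]
    · simp [P, ← mul_assoc, ← hAB]
    · simp [P, ← mul_assoc, hB]
    · rw [hAB]
      simp [P, ← mul_assoc, hB]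
  have hgen (i : Fin 3) : ((σ i : B4S2) : B4S2 ⧸ squaresSubgroup) = A ∨
      ((σ i : B4S2) : B4S2 ⧸ squaresSubgroup) = B := by
    fin_cases i
    exacts [.inl rfl, .inr rfl, .inl hC]
  have hP : P g := by
    have hg : g ∈ Subgroup.closure (Set.range σ) := by
      refine PresentedGroup.generated_by _ _ (fun i => ?_) g
      exact Subgroup.subset_closure ⟨i, rfl⟩
    induction hg using Subgroup.closure_induction_left with
    | one => exact .inl rfl
    | mul_left _ hx y _ ih =>
      obtain ⟨i, rfl⟩ := hx
      rw [QuotientGroup.mk_mul]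
      rcases hgen i with h | h <;> rw [h]
      exacts [hPA _ ih, hPB _ ih]
    | inv_mul_cancel _ hx y _ ih =>
      obtain ⟨i, rfl⟩ := hx
      rw [QuotientGroup.mk_mul, QuotientGroup.mk_inv]
      rcases hgen i with h | h <;> rw [h]
      · rw [inv_eq_of_mul_eq_one_left hA]
        exact hPA _ ih
      · rw [inv_eq_of_mul_eq_one_left hB]
        exact hPB _ ih
  rcases hP with h | h | h | h | h | h <;> rw [h]
  exacts [⟨1, by simp [cosetReps], rfl⟩, ⟨σ 0, by simp [cosetReps], rfl⟩,
    ⟨σ 1, by simp [cosetReps], rfl⟩, ⟨σ 0 * σ 1, by simp [cosetReps], rfl⟩,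
    ⟨σ 1 * σ 0, by simp [cosetReps], rfl⟩, ⟨σ 0 * σ 1 * σ 0, by simp [cosetReps], rfl⟩]

theorem exists_conj_eq_pow_of_mem_Kconj {g x : B4S2} (hg : g ∈ Kconj) (hx : x ∈ Qsub)
    (h4 : x ^ 4 = 1) (h2 : x ^ 2 ≠ 1) : ∃ k : Fin 4, g * x * g⁻¹ = x ^ (k : ℕ) := by
  have ho : orderOf x = 4 := orderOf_eq_prime_pow (p := 2) (n := 1) h2 h4
  have h := hg (Subgroup.zpowers x) (by simpa using hx) (by rw [Nat.card_zpowers, ho])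
  have hmem : g * x * g⁻¹ ∈ Subgroup.zpowers x := by
    rw [← h]
    exact ⟨x, Subgroup.mem_zpowers x, rfl⟩
  have hfin : IsOfFinOrder x := orderOf_pos_iff.mp (by omega)
  obtain ⟨n, hn⟩ := hfin.mem_powers_iff_mem_zpowers.mpr hmem
  exact ⟨⟨n % 4, by omega⟩, hn.symm.trans (pow_eq_pow_mod n h4)⟩

theorem eq_one_of_mem_cosetReps_of_mem_Kconj {t : B4S2} (ht : t ∈ cosetReps) (hK : t ∈ Kconj) :
    t = 1 := by
  have h2 : (α₀ ^ 2) ^ 2 ≠ 1 := fun h => by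
    have := congrArg sphereBraidRep h
    simp only [α₀, map_pow, map_mul, sphereBraidRep_σ, map_one] at this
    revert this
    decide
  obtain ⟨k, hk⟩ := exists_conj_eq_pow_of_mem_Kconj hK
    (Subgroup.subset_closure (by simp)) α₀_sq_pow_four h2
  obtain ⟨l, hl⟩ := exists_conj_eq_pow_of_mem_Kconj hK
    (Subgroup.subset_closure (by simp)) Δ₄_pow_four (α₀_sq_sq ▸ h2)
  replace hk := congrArg sphereBraidRep hk
  replace hl := congrArg sphereBraidRep hl
  simp only [cosetReps, List.mem_cons, List.not_mem_nil, or_false] at ht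
  rcases ht with rfl | rfl | rfl | rfl | rfl | rfl
  · rfl
  iterate 4
    exfalso
    simp only [α₀, map_pow, map_mul, map_inv, sphereBraidRep_σ] at hk
    revert k
    decide
  · exfalso
    simp only [Δ₄, map_pow, map_mul, map_inv, sphereBraidRep_σ] at hl
    revert l
    decide

theorem range_quaternionProdFreeHom : quaternionProdFreeHom.range = Kconj := by
  refine le_antisymm range_quaternionProdFreeHom_le_Kconj fun g hg => ?_
  obtain ⟨t, ht, htg⟩ := exists_mem_cosetReps g
  have hmem := squaresSubgroup_le_range (QuotientGroup.eq.mp htg)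
  have htK : t ∈ Kconj := by
    simpa using mul_mem hg (inv_mem (range_quaternionProdFreeHom_le_Kconj hmem))
  rw [eq_one_of_mem_cosetReps_of_mem_Kconj ht htK] at hmem
  simpa using hmem

end Kernel

/-- The kernel `K` of the conjugation action of `B₄(S²)` on the set of
cyclic subgroups of `Q` of order `4` is isomorphic to `Q₈ × F₂`, a basis of the free factor
being given by `x = α₀²Δ₄σ₁²` and `y = Δ₄σ₂²`. -/
theorem kernel_iso_Q8_prod_freeGroup :
    ∃ e : Kconj ≃* QuaternionGroup 2 × FreeGroup (Fin 2),
      ((e.symm (1, FreeGroup.of 0) : Kconj) : B4S2) = α₀ ^ 2 * Δ₄ * σ 0 ^ 2 ∧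
      ((e.symm (1, FreeGroup.of 1) : Kconj) : B4S2) = Δ₄ * σ 1 ^ 2 := by
  refine ⟨((MonoidHom.ofInjective quaternionProdFreeHom_injective).trans
    (MulEquiv.subgroupCongr range_quaternionProdFreeHom)).symm, ?_, ?_⟩
  · change quaternionHom 1 * freeFactorHom (.of 0) = _
    rw [map_one, one_mul, freeFactorHom_of_zero]
  · change quaternionHom 1 * freeFactorHom (.of 1) = _
    rw [map_one, one_mul, freeFactorHom_of_one]
end

section
/- In B₄(S²), set x = α₀²Δ₄σ₁², y = Δ₄σ₂², and Δ = Δ₄². Then the following conjugation identities hold: σ₁xσ₁⁻¹ = x; σ₁yσ₁⁻¹ = y⁻¹x⁻¹; σ₂xσ₂⁻¹ = Δx⁻¹y⁻¹; σ₂yσ₂⁻¹ = y; (σ₁σ₂σ₁)x(σ₁σ₂σ₁)⁻¹ = Δy; (σ₁σ₂σ₁)y(σ₁σ₂σ₁)⁻¹ = Δx; (σ₁σ₂)x(σ₁σ₂)⁻¹ = Δy; (σ₁σ₂)y(σ₁σ₂)⁻¹ = y⁻¹x⁻¹; (σ₂σ₁)x(σ₂σ₁)⁻¹ = Δx⁻¹y⁻¹;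 (σ₂σ₁)y(σ₂σ₁)⁻¹ = Δx. -/
/-- `x = α₀²Δ₄σ₁²`. -/
def xElt : B4S2 := α₀ ^ 2 * Δ₄ * σ 0 ^ 2

/-- `y = Δ₄σ₂²`. -/
def yElt : B4S2 := Δ₄ * σ 1 ^ 2

/-- The full twist `Δ = Δ₄²`. -/
def Δ : B4S2 := Δ₄ ^ 2

/-- Multiplies an identity between products of two elements on the right by an arbitrary element. -/
theorem mul_mul_eq_of_mul_eq {G : Type*} [Semigroup G] {a b c : G} (h : a * b = c) (d : G) :
    a * (b * d) = c * d := by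
  rw [← mul_assoc, h]

namespace B4S2

theorem σ_zero_mul_σ_two : σ 0 * σ 2 = σ 2 * σ 0 :=
  mul_inv_eq_one.mp (PresentedGroup.one_of_mem (rels := sphereBraidRels)
    (by simp [sphereBraidRels]))

theorem σ_braid_zero_one : σ 0 * σ 1 * σ 0 = σ 1 * σ 0 * σ 1 :=
  mul_inv_eq_one.mp (PresentedGroup.one_of_mem (rels := sphereBraidRels)
    (by simp [sphereBraidRels]))

theorem σ_braid_one_two : σ 1 * σ 2 * σ 1 = σ 2 * σ 1 * σ 2 :=
  mul_inv_eq_one.mp (PresentedGroup.one_of_mem (rels := sphereBraidRels)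
    (by simp [sphereBraidRels]))

theorem σ_sphere : σ 0 * σ 1 * σ 2 ^ 2 * σ 1 * σ 0 = 1 :=
  PresentedGroup.one_of_mem (rels := sphereBraidRels) (by simp [sphereBraidRels])

theorem α₀_mul_σ_zero : α₀ * σ 0 = σ 1 * α₀ := by
  calc α₀ * σ 0 = σ 0 * σ 1 * (σ 2 * σ 0) := by simp only [α₀, mul_assoc]
    _ = (σ 0 * σ 1 * σ 0) * σ 2 := by rw [← σ_zero_mul_σ_two]; simp only [mul_assoc]
    _ = σ 1 * α₀ := by rw [σ_braid_zero_one]; simp only [α₀, mul_assoc]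

theorem α₀_mul_σ_one : α₀ * σ 1 = σ 2 * α₀ := by
  calc α₀ * σ 1 = σ 0 * (σ 1 * σ 2 * σ 1) := by simp only [α₀, mul_assoc]
    _ = (σ 0 * σ 2) * σ 1 * σ 2 := by rw [σ_braid_one_two]; simp only [mul_assoc]
    _ = σ 2 * α₀ := by rw [σ_zero_mul_σ_two]; simp only [α₀, mul_assoc]

theorem Δ₄_eq_α₀_mul : Δ₄ = α₀ * (σ 0 * σ 1 * σ 0) := by
  simp only [Δ₄, α₀, mul_assoc]

theorem α₀_mul_rev : α₀ * (σ 2 * σ 1 * σ 0) = 1 := by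
  rw [← σ_sphere]; simp only [α₀, pow_two, mul_assoc]

theorem Δ₄_mul_σ_zero : Δ₄ * σ 0 = σ 2 * Δ₄ := by
  calc Δ₄ * σ 0 = α₀ * σ 1 * (σ 0 * σ 1 * σ 0) := by
        rw [Δ₄_eq_α₀_mul]; nth_rewrite 1 [σ_braid_zero_one]; simp only [mul_assoc]
    _ = σ 2 * Δ₄ := by rw [α₀_mul_σ_one, Δ₄_eq_α₀_mul, mul_assoc]

theorem Δ₄_mul_σ_one : Δ₄ * σ 1 = σ 1 * Δ₄ := by
  calc Δ₄ * σ 1 = α₀ * (σ 0 * (σ 1 * σ 0 * σ 1)) := by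
        rw [Δ₄_eq_α₀_mul]; simp only [mul_assoc]
    _ = α₀ * σ 0 * (σ 0 * σ 1 * σ 0) := by rw [← σ_braid_zero_one, mul_assoc α₀]
    _ = σ 1 * Δ₄ := by rw [α₀_mul_σ_zero, Δ₄_eq_α₀_mul, mul_assoc]

theorem σ_zero_mul_Δ₄ : σ 0 * Δ₄ = α₀ ^ 2 * σ 0 := by
  have h : Δ₄ = σ 1 * α₀ * σ 1 * σ 0 := by
    rw [Δ₄_eq_α₀_mul, ← α₀_mul_σ_zero]; simp only [mul_assoc]
  calc σ 0 * Δ₄ = σ 0 * σ 1 * (α₀ * σ 1) * σ 0 := by rw [h]; simp only [mul_assoc]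
    _ = α₀ ^ 2 * σ 0 := by rw [α₀_mul_σ_one, pow_two]; simp only [α₀, mul_assoc]

theorem Δ₄_mul_σ_two : Δ₄ * σ 2 = σ 0 * Δ₄ := by
  calc Δ₄ * σ 2 = α₀ * (σ 0 * σ 1 * (σ 0 * σ 2)) := by
        rw [Δ₄_eq_α₀_mul]; simp only [mul_assoc]
    _ = α₀ ^ 2 * σ 0 := by rw [σ_zero_mul_σ_two, pow_two]; simp only [α₀, mul_assoc]
    _ = σ 0 * Δ₄ := σ_zero_mul_Δ₄.symm

theorem Δ₄_mul_α₀ : Δ₄ * α₀ = α₀⁻¹ * Δ₄ := by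
  rw [← eq_inv_of_mul_eq_one_right α₀_mul_rev]
  calc Δ₄ * α₀ = Δ₄ * σ 0 * σ 1 * σ 2 := by simp only [α₀, mul_assoc]
    _ = σ 2 * (Δ₄ * σ 1) * σ 2 := by rw [Δ₄_mul_σ_zero]; simp only [mul_assoc]
    _ = σ 2 * σ 1 * (Δ₄ * σ 2) := by rw [Δ₄_mul_σ_one]; simp only [mul_assoc]
    _ = σ 2 * σ 1 * σ 0 * Δ₄ := by rw [Δ₄_mul_σ_two]; simp only [mul_assoc]

theorem Δ₄_mul_Δ₄ : Δ₄ * Δ₄ = σ 0 * σ 1 * σ 0 * (σ 0 * σ 1 * σ 0) := by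
  calc Δ₄ * Δ₄ = Δ₄ * α₀ * (σ 0 * σ 1 * σ 0) := by
        conv_lhs => rw [Δ₄_eq_α₀_mul]
        rw [Δ₄_eq_α₀_mul]; simp only [mul_assoc]
    _ = σ 0 * σ 1 * σ 0 * (σ 0 * σ 1 * σ 0) := by
        rw [Δ₄_mul_α₀, Δ₄_eq_α₀_mul]; simp only [mul_assoc, inv_mul_cancel_left]

theorem α₀_sq_mul_α₀_sq : α₀ ^ 2 * α₀ ^ 2 = Δ := by
  have h : σ 0 * σ 1 * σ 0 * Δ₄ = Δ₄ * (σ 2 * σ 1 * σ 2) := by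
    calc σ 0 * σ 1 * σ 0 * Δ₄ = σ 0 * σ 1 * (Δ₄ * σ 2) := by
          rw [Δ₄_mul_σ_two]; simp only [mul_assoc]
      _ = σ 0 * (Δ₄ * σ 1) * σ 2 := by rw [Δ₄_mul_σ_one]; simp only [mul_assoc]
      _ = Δ₄ * (σ 2 * σ 1 * σ 2) := by
          rw [← mul_assoc, ← Δ₄_mul_σ_two]; simp only [mul_assoc]
  symm
  calc Δ = α₀ * (σ 0 * σ 1 * σ 0 * Δ₄) := by
        rw [Δ, pow_two]; nth_rewrite 1 [Δ₄_eq_α₀_mul]; simp only [mul_assoc]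
    _ = α₀ * α₀ * (σ 0 * σ 1 * (σ 0 * σ 2) * σ 1 * σ 2) := by
        rw [h, Δ₄_eq_α₀_mul]; simp only [mul_assoc]
    _ = α₀ ^ 2 * α₀ ^ 2 := by
        rw [σ_zero_mul_σ_two, pow_two]; simp only [α₀, mul_assoc]

theorem σ_zero_mul_Δ : σ 0 * Δ = Δ * σ 0 := by
  rw [Δ, pow_two, ← mul_assoc, ← Δ₄_mul_σ_two, mul_assoc, ← Δ₄_mul_σ_zero, mul_assoc]

theorem σ_one_mul_Δ : σ 1 * Δ = Δ * σ 1 := by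
  rw [Δ, pow_two, ← mul_assoc, ← Δ₄_mul_σ_one, mul_assoc, ← Δ₄_mul_σ_one, mul_assoc]

theorem Δ₄_mul_Δ : Δ₄ * Δ = Δ * Δ₄ := by
  rw [Δ, pow_two, mul_assoc]

theorem α₀_sq_mul_Δ : α₀ ^ 2 * Δ = Δ * α₀ ^ 2 := by
  rw [← α₀_sq_mul_α₀_sq, mul_assoc]

theorem Δ₄_mul_α₀_sq_eq_inv_mul : Δ₄ * α₀ ^ 2 = (α₀ ^ 2)⁻¹ * Δ₄ := by
  rw [pow_two, ← mul_assoc, Δ₄_mul_α₀, mul_assoc, Δ₄_mul_α₀, mul_inv_rev, mul_assoc]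

theorem Δ_mul_Δ : Δ * Δ = 1 := by
  have h : Δ₄ * Δ = Δ⁻¹ * Δ₄ := by
    rw [← α₀_sq_mul_α₀_sq, ← mul_assoc, Δ₄_mul_α₀_sq_eq_inv_mul, mul_assoc,
      Δ₄_mul_α₀_sq_eq_inv_mul, mul_inv_rev, mul_assoc]
  rw [Δ₄_mul_Δ, mul_left_inj] at h
  rw [mul_eq_one_iff_eq_inv, ← h]

theorem Δ_inv : Δ⁻¹ = Δ := inv_eq_of_mul_eq_one_left Δ_mul_Δ

theorem α₀_sq_inv : (α₀ ^ 2)⁻¹ = Δ * α₀ ^ 2 := by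
  rw [inv_eq_iff_mul_eq_one, ← mul_assoc, α₀_sq_mul_Δ, mul_assoc, α₀_sq_mul_α₀_sq, Δ_mul_Δ]

theorem Δ₄_mul_α₀_sq : Δ₄ * α₀ ^ 2 = Δ * (α₀ ^ 2 * Δ₄) := by
  rw [Δ₄_mul_α₀_sq_eq_inv_mul, α₀_sq_inv, mul_assoc]

theorem σ_one_mul_α₀_sq : σ 1 * α₀ ^ 2 = Δ * (α₀ ^ 2 * (Δ₄ * σ 1)) := by
  have hα : α₀ * Δ₄ * α₀ = Δ₄ := by rw [mul_assoc, Δ₄_mul_α₀, mul_inv_cancel_left]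
  have h : σ 1 * (α₀ ^ 2 * Δ₄) = α₀ ^ 2 * σ 1 := by
    rw [← mul_left_inj α₀]
    calc σ 1 * (α₀ ^ 2 * Δ₄) * α₀ = σ 1 * α₀ * (α₀ * Δ₄ * α₀) := by
          simp only [pow_two, mul_assoc]
      _ = α₀ * (σ 0 * Δ₄) := by rw [hα, ← α₀_mul_σ_zero, mul_assoc]
      _ = α₀ ^ 2 * (α₀ * σ 0) := by rw [σ_zero_mul_Δ₄]; simp only [pow_two, mul_assoc]
      _ = α₀ ^ 2 * σ 1 * α₀ := by rw [α₀_mul_σ_zero, mul_assoc]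
  rw [← mul_left_inj Δ₄, mul_assoc, h]
  simp only [mul_assoc]
  rw [← Δ₄_mul_σ_one, ← mul_assoc Δ₄, ← pow_two Δ₄, ← Δ, ← mul_assoc (α₀ ^ 2), α₀_sq_mul_Δ,
    mul_assoc, ← mul_assoc Δ, Δ_mul_Δ, one_mul]

theorem σ_zero_mul_α₀_sq : σ 0 * α₀ ^ 2 = Δ * (Δ₄ * σ 0) := by
  have h : α₀ ^ 2 * σ 0 = σ 2 * α₀ ^ 2 := by
    rw [pow_two, mul_assoc, α₀_mul_σ_zero, ← mul_assoc, α₀_mul_σ_one, mul_assoc]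
  have h_two : σ 0 * α₀ ^ 2 = α₀ ^ 2 * σ 2 := by
    rw [← mul_left_inj (α₀ ^ 2), mul_assoc, α₀_sq_mul_α₀_sq, mul_assoc, ← h, ← mul_assoc,
      α₀_sq_mul_α₀_sq, σ_zero_mul_Δ]
  rw [← mul_right_inj Δ₄]
  calc Δ₄ * (σ 0 * α₀ ^ 2) = Δ * (α₀ ^ 2 * (Δ₄ * σ 2)) := by
        rw [h_two, ← mul_assoc, Δ₄_mul_α₀_sq]; simp only [mul_assoc]
    _ = Δ * (Δ * σ 0) := by
        rw [Δ₄_mul_σ_two, σ_zero_mul_Δ₄, ← mul_assoc (α₀ ^ 2), α₀_sq_mul_α₀_sq]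
    _ = Δ₄ * (Δ * (Δ₄ * σ 0)) := by
        rw [← mul_assoc Δ₄, Δ₄_mul_Δ, mul_assoc, ← mul_assoc Δ₄, ← pow_two, ← Δ]

theorem σ_one_zero_sq_one_zero_sq : σ 1 * (σ 0 * (σ 0 * (σ 1 * (σ 0 * σ 0)))) = Δ := by
  have h := σ_braid_zero_one
  calc σ 1 * (σ 0 * (σ 0 * (σ 1 * (σ 0 * σ 0)))) = σ 1 * σ 0 * (σ 0 * σ 1 * σ 0) * σ 0 := by
        simp only [mul_assoc]
    _ = σ 1 * σ 0 * (σ 1 * σ 0 * σ 1) * σ 0 := by rw [h]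
    _ = σ 1 * σ 0 * σ 1 * (σ 0 * σ 1 * σ 0) := by simp only [mul_assoc]
    _ = Δ := by rw [← h, ← Δ₄_mul_Δ₄, Δ, pow_two]

theorem σ_zero_one_sq_zero_one_sq : σ 0 * (σ 1 * (σ 1 * (σ 0 * (σ 1 * σ 1)))) = Δ := by
  have h := σ_braid_zero_one
  calc σ 0 * (σ 1 * (σ 1 * (σ 0 * (σ 1 * σ 1)))) = σ 0 * σ 1 * (σ 1 * σ 0 * σ 1) * σ 1 := by
        simp only [mul_assoc]
    _ = σ 0 * σ 1 * (σ 0 * σ 1 * σ 0) * σ 1 := by rw [h]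
    _ = σ 0 * σ 1 * σ 0 * (σ 1 * σ 0 * σ 1) := by simp only [mul_assoc]
    _ = Δ := by rw [← h, ← Δ₄_mul_Δ₄, Δ, pow_two]

theorem Δ₄_mul_Δ₄_eq_Δ : Δ₄ * Δ₄ = Δ := (pow_two Δ₄).symm

theorem σ_one_mul_Δ₄ : σ 1 * Δ₄ = Δ₄ * σ 1 := Δ₄_mul_σ_one.symm

theorem σ_zero_mul_xElt : σ 0 * xElt = xElt * σ 0 := by
  simp only [xElt, pow_two (σ _), mul_assoc, one_mul, mul_mul_eq_of_mul_eq Δ_mul_Δ,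
    mul_mul_eq_of_mul_eq Δ₄_mul_α₀_sq, mul_mul_eq_of_mul_eq σ_zero_mul_Δ₄,
    mul_mul_eq_of_mul_eq σ_zero_mul_α₀_sq]

theorem σ_one_mul_yElt : σ 1 * yElt = yElt * σ 1 := by
  rw [yElt, ← mul_assoc, ← Δ₄_mul_σ_one, mul_assoc, mul_assoc, ← pow_succ', pow_succ]

theorem σ_zero_conj_xElt : σ 0 * xElt * (σ 0)⁻¹ = xElt := by
  rw [mul_inv_eq_iff_eq_mul, σ_zero_mul_xElt]

theorem σ_zero_conj_yElt : σ 0 * yElt * (σ 0)⁻¹ = yElt⁻¹ * xElt⁻¹ := by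
  have h : (σ 0)⁻¹ * xElt = α₀ ^ 2 * Δ₄ * σ 0 := by
    rw [inv_mul_eq_iff_eq_mul, ← mul_left_inj (σ 0), ← σ_zero_mul_xElt, xElt]
    simp only [pow_two (σ _), mul_assoc]
  rw [← mul_inv_rev, eq_inv_iff_mul_eq_one, ← mul_assoc, mul_assoc (σ 0 * yElt), h]
  simp only [yElt, pow_two (σ _), mul_assoc, one_mul, Δ₄_mul_Δ, Δ_mul_Δ, Δ₄_mul_Δ₄_eq_Δ,
    mul_mul_eq_of_mul_eq σ_zero_mul_Δ, mul_mul_eq_of_mul_eq σ_one_mul_Δ,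
    mul_mul_eq_of_mul_eq Δ₄_mul_Δ, mul_mul_eq_of_mul_eq α₀_sq_mul_Δ, mul_mul_eq_of_mul_eq Δ_mul_Δ,
    mul_mul_eq_of_mul_eq α₀_sq_mul_α₀_sq, mul_mul_eq_of_mul_eq Δ₄_mul_Δ₄_eq_Δ,
    mul_mul_eq_of_mul_eq Δ₄_mul_α₀_sq, mul_mul_eq_of_mul_eq σ_zero_mul_Δ₄,
    mul_mul_eq_of_mul_eq σ_zero_mul_α₀_sq, mul_mul_eq_of_mul_eq σ_one_mul_Δ₄,
    mul_mul_eq_of_mul_eq σ_one_mul_α₀_sq, σ_zero_one_sq_zero_one_sq]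

theorem σ_one_conj_xElt : σ 1 * xElt * (σ 1)⁻¹ = Δ * xElt⁻¹ * yElt⁻¹ := by
  have h : (σ 1)⁻¹ * yElt = Δ₄ * σ 1 := by
    rw [inv_mul_eq_iff_eq_mul, ← mul_left_inj (σ 1), ← σ_one_mul_yElt, yElt]
    simp only [pow_two (σ _), mul_assoc]
  rw [eq_mul_inv_iff_mul_eq, eq_mul_inv_iff_mul_eq, mul_assoc (σ 1 * xElt), h]
  simp only [xElt, pow_two (σ _), mul_assoc, one_mul, mul_one, Δ₄_mul_Δ, α₀_sq_mul_Δ, Δ_mul_Δ,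
    α₀_sq_mul_α₀_sq, Δ₄_mul_Δ₄_eq_Δ, mul_mul_eq_of_mul_eq σ_zero_mul_Δ,
    mul_mul_eq_of_mul_eq σ_one_mul_Δ, mul_mul_eq_of_mul_eq Δ₄_mul_Δ,
    mul_mul_eq_of_mul_eq α₀_sq_mul_Δ, mul_mul_eq_of_mul_eq Δ_mul_Δ,
    mul_mul_eq_of_mul_eq Δ₄_mul_Δ₄_eq_Δ, mul_mul_eq_of_mul_eq Δ₄_mul_α₀_sq,
    mul_mul_eq_of_mul_eq σ_zero_mul_Δ₄, mul_mul_eq_of_mul_eq σ_zero_mul_α₀_sq,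
    mul_mul_eq_of_mul_eq σ_one_mul_Δ₄, mul_mul_eq_of_mul_eq σ_one_mul_α₀_sq,
    σ_one_zero_sq_one_zero_sq]

theorem σ_one_conj_yElt : σ 1 * yElt * (σ 1)⁻¹ = yElt := by
  rw [mul_inv_eq_iff_eq_mul, σ_one_mul_yElt]

end B4S2

/-- Conjugation identities in `B₄(S²)` for `x = α₀²Δ₄σ₁²`, `y = Δ₄σ₂²`
and the full twist `Δ = Δ₄²`. -/
theorem conj_identities_B4S2 :
    σ 0 * xElt * (σ 0)⁻¹ = xElt ∧
    σ 0 * yElt * (σ 0)⁻¹ = yElt⁻¹ * xElt⁻¹ ∧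
    σ 1 * xElt * (σ 1)⁻¹ = Δ * xElt⁻¹ * yElt⁻¹ ∧
    σ 1 * yElt * (σ 1)⁻¹ = yElt ∧
    (σ 0 * σ 1 * σ 0) * xElt * (σ 0 * σ 1 * σ 0)⁻¹ = Δ * yElt ∧
    (σ 0 * σ 1 * σ 0) * yElt * (σ 0 * σ 1 * σ 0)⁻¹ = Δ * xElt ∧
    (σ 0 * σ 1) * xElt * (σ 0 * σ 1)⁻¹ = Δ * yElt ∧
    (σ 0 * σ 1) * yElt * (σ 0 * σ 1)⁻¹ = yElt⁻¹ * xElt⁻¹ ∧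
    (σ 1 * σ 0) * xElt * (σ 1 * σ 0)⁻¹ = Δ * xElt⁻¹ * yElt⁻¹ ∧
    (σ 1 * σ 0) * yElt * (σ 1 * σ 0)⁻¹ = Δ * xElt := by
  have hx₀ : MulAut.conj (σ 0) xElt = xElt := B4S2.σ_zero_conj_xElt
  have hy₀ : MulAut.conj (σ 0) yElt = yElt⁻¹ * xElt⁻¹ := B4S2.σ_zero_conj_yElt
  have hx₁ : MulAut.conj (σ 1) xElt = Δ * xElt⁻¹ * yElt⁻¹ := B4S2.σ_one_conj_xElt
  have hy₁ : MulAut.conj (σ 1) yElt = yElt := B4S2.σ_one_conj_yElt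
  have hΔ₀ : MulAut.conj (σ 0) Δ = Δ := by
    rw [MulAut.conj_apply, B4S2.σ_zero_mul_Δ, mul_inv_cancel_right]
  simp only [← MulAut.conj_apply, map_mul, MulAut.mul_apply, hx₀, hy₀, hx₁, hy₁, hΔ₀, map_inv,
    true_and]
  have hxΔ : xElt * Δ⁻¹ = Δ * xElt := by
    rw [B4S2.Δ_inv]
    exact Commute.mul_left (Commute.mul_left B4S2.α₀_sq_mul_Δ B4S2.Δ₄_mul_Δ)
      (Commute.pow_left B4S2.σ_zero_mul_Δ 2)
  refine ⟨?_, ?_, ?_, ?_⟩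
  · group
  · rw [← hxΔ]; group
  · group
  · rw [← hxΔ]; group
end
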